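/- Let n ≥ 3 and let 0 ≤ a < (n-2)/2, 0 < b, a ≤ b < a+1, p = 2n/(n-2+2(b-a)), ν > 0, α, β > 1 with α + β = p. Let (u, v) be a positive finite-energy solution of the Hénon–Sobolev system (S). Then there exist positive constants u₀, v₀, u_∞, v_∞ such that lim_{x → 0} u(x) = u₀, lim_{x → 0} v(x) = v₀, lim_{|x| → ∞} |x|^{n-2-2a} u(x) = u_∞ and lim_{|x| → ∞} |x|^{n-2-2a} v(x) = v_∞. -/

import Mathlib

open MeasureTheory Real Filter Topology

noncomputable section

/-- Coordinate Laplacian on Euclidean space. -/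
def lapl {n : ℕ} (w : EuclideanSpace ℝ (Fin n) → ℝ) (x : EuclideanSpace ℝ (Fin n)) : ℝ :=
  ∑ i : Fin n, fderiv ℝ (fun y => fderiv ℝ w y (EuclideanSpace.single i 1)) x
    (EuclideanSpace.single i 1)

/-- The weighted divergence `div(|x|^(-2a) ∇w)(x) = |x|^(-2a) (Δw(x) - 2a⟨x,∇w(x)⟩/|x|²)`. -/
def wdiv {n : ℕ} (a : ℝ) (w : EuclideanSpace ℝ (Fin n) → ℝ) (x : EuclideanSpace ℝ (Fin n)) : ℝ :=
  ‖x‖ ^ (-(2*a)) * (lapl w x - 2*a * (@inner ℝ _ _ x (gradient w x)) / ‖x‖^2)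

/-- Finiteness of the weighted Dirichlet energy `∫ |x|^(-2a) |∇w|² < ∞`. -/
def finiteEnergy {n : ℕ} (a : ℝ) (w : EuclideanSpace ℝ (Fin n) → ℝ) : Prop :=
  Integrable (fun x : EuclideanSpace ℝ (Fin n) => ‖x‖ ^ (-(2*a)) * ‖gradient w x‖^2)

/-- Euclidean space of dimension `n`. -/
abbrev Eu (n : ℕ) := EuclideanSpace ℝ (Fin n)

section Laplacian

variable {n : ℕ} {f g w : Eu n → ℝ} {x : Eu n}

lemma ContDiffAt.eventually_differentiableAt (hf : ContDiffAt ℝ 2 f x) :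
    ∀ᶠ y in 𝓝 x, DifferentiableAt ℝ f y := by
  filter_upwards [hf.eventually (by simp)] with y hy using hy.differentiableAt (by simp)

lemma ContDiffAt.differentiableAt_fderiv (hf : ContDiffAt ℝ 2 f x) :
    DifferentiableAt ℝ (fderiv ℝ f) x :=
  (hf.fderiv_right (m := 1) (by norm_num)).differentiableAt (by simp)

lemma fderiv_fderiv_apply (hf : ContDiffAt ℝ 2 f x) (v : Eu n) :
    fderiv ℝ (fun y => fderiv ℝ f y v) x v = fderiv ℝ (fderiv ℝ f) x v v := by
  rw [fderiv_clm_apply hf.differentiableAt_fderiv (differentiableAt_const v)]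
  simp

lemma lapl_congr (h : f =ᶠ[𝓝 x] g) : lapl f x = lapl g x := by
  unfold lapl
  refine Finset.sum_congr rfl fun i _ => ?_
  have : (fun y => fderiv ℝ f y (EuclideanSpace.single i 1)) =ᶠ[𝓝 x]
      (fun y => fderiv ℝ g y (EuclideanSpace.single i 1)) := by
    filter_upwards [h.eventuallyEq_nhds] with y hy
    rw [hy.fderiv_eq]
  rw [this.fderiv_eq]

lemma lapl_mul (hf : ContDiffAt ℝ 2 f x) (hg : ContDiffAt ℝ 2 g x) :
    lapl (fun y => f y * g y) x = f x * lapl g x + g x * lapl f x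
      + 2 * ∑ i, fderiv ℝ f x (EuclideanSpace.single i 1)
        * fderiv ℝ g x (EuclideanSpace.single i 1) := by
  unfold lapl
  rw [Finset.mul_sum, Finset.mul_sum, Finset.mul_sum, ← Finset.sum_add_distrib,
    ← Finset.sum_add_distrib]
  refine Finset.sum_congr rfl fun i _ => ?_
  set e : Eu n := EuclideanSpace.single i 1
  have h1 : (fun y => fderiv ℝ (fun y => f y * g y) y e) =ᶠ[𝓝 x]
      fun y => f y * fderiv ℝ g y e + g y * fderiv ℝ f y e := by
    filter_upwards [hf.eventually_differentiableAt, hg.eventually_differentiableAt] with y h1 h2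
    rw [fderiv_fun_mul h1 h2]
    simp
  rw [h1.fderiv_eq]
  have df := hf.differentiableAt (by simp)
  have dg := hg.differentiableAt (by simp)
  have df' : DifferentiableAt ℝ (fun y => fderiv ℝ f y e) x :=
    hf.differentiableAt_fderiv.clm_apply (differentiableAt_const e)
  have dg' : DifferentiableAt ℝ (fun y => fderiv ℝ g y e) x :=
    hg.differentiableAt_fderiv.clm_apply (differentiableAt_const e)
  rw [fderiv_fun_add (df.fun_mul dg') (dg.fun_mul df'), fderiv_fun_mul df dg',
    fderiv_fun_mul dg df']
  simp
  ring

lemma lapl_add (hf : ContDiffAt ℝ 2 f x) (hg : ContDiffAt ℝ 2 g x) :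
    lapl (fun y => f y + g y) x = lapl f x + lapl g x := by
  unfold lapl
  rw [← Finset.sum_add_distrib]
  refine Finset.sum_congr rfl fun i _ => ?_
  set e : Eu n := EuclideanSpace.single i 1
  have h1 : (fun y => fderiv ℝ (fun y => f y + g y) y e) =ᶠ[𝓝 x]
      fun y => fderiv ℝ f y e + fderiv ℝ g y e := by
    filter_upwards [hf.eventually_differentiableAt, hg.eventually_differentiableAt] with y h1 h2
    rw [fderiv_fun_add h1 h2]
    simp
  rw [h1.fderiv_eq, fderiv_fun_add]
  · simp
  · exact hf.differentiableAt_fderiv.clm_apply (differentiableAt_const e)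
  · exact hg.differentiableAt_fderiv.clm_apply (differentiableAt_const e)

lemma lapl_const_mul (hf : ContDiffAt ℝ 2 f x) (c : ℝ) :
    lapl (fun y => c * f y) x = c * lapl f x := by
  rw [lapl_mul contDiffAt_const hf]
  have : lapl (fun _ : Eu n => c) x = 0 := by simp [lapl]
  simp [this]

lemma fderiv_comp_affine (z y : Eu n) (σ : ℝ) :
    fderiv ℝ (fun y => f (z + σ • y)) y = σ • fderiv ℝ f (z + σ • y) := by
  have := fderiv_comp_smul (𝕜 := ℝ) (f := fun y => f (z + y)) (x := y) σ
  rw [this, fderiv_comp_add_left]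

lemma lapl_comp_affine (z y : Eu n) (σ : ℝ) :
    lapl (fun y => f (z + σ • y)) y = σ ^ 2 * lapl f (z + σ • y) := by
  unfold lapl
  rw [Finset.mul_sum]
  refine Finset.sum_congr rfl fun i _ => ?_
  set e : Eu n := EuclideanSpace.single i 1
  have : (fun y => fderiv ℝ (fun y => f (z + σ • y)) y e) =
      σ • fun y => (fun q => fderiv ℝ f q e) (z + σ • y) := by
    funext y
    rw [fderiv_comp_affine]
    simp
  rw [this, fderiv_const_smul_field, Pi.smul_apply,
    fderiv_comp_affine (f := fun q => fderiv ℝ f q e)]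
  simp
  ring

lemma lapl_eq_laplacian (hf : ContDiffAt ℝ 2 f x) :
    lapl f x = Laplacian.laplacian f x := by
  rw [InnerProductSpace.laplacian_eq_iteratedFDeriv_orthonormalBasis f
    (EuclideanSpace.basisFun (Fin n) ℝ)]
  unfold lapl
  refine Finset.sum_congr rfl fun i _ => ?_
  rw [fderiv_fderiv_apply hf, iteratedFDeriv_two_apply]
  simp

lemma lapl_comp_isometry (R : Eu n ≃ₗᵢ[ℝ] Eu n) (hf : ContDiffAt ℝ 2 f (R x)) :
    lapl (fun y => f (R y)) x = lapl f (R x) := by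
  have hc : ContDiffAt ℝ 2 (fun y => f (R y)) x := hf.comp x R.contDiff.contDiffAt
  rw [lapl_eq_laplacian hf, InnerProductSpace.laplacian_eq_iteratedFDeriv_orthonormalBasis f
    ((EuclideanSpace.basisFun (Fin n) ℝ).map R)]
  unfold lapl
  refine Finset.sum_congr rfl fun i _ => ?_
  set e : Eu n := EuclideanSpace.single i 1
  have h1 : (fun y => fderiv ℝ (fun y => f (R y)) y e) =ᶠ[𝓝 x]
      fun y => (fun z => fderiv ℝ f z (R e)) (R y) := by
    have := R.continuous.continuousAt.eventually hf.eventually_differentiableAt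
    filter_upwards [this] with y hy
    have h2 : HasFDerivAt (fun y => f (R y))
        ((fderiv ℝ f (R y)).comp (R.toContinuousLinearEquiv : Eu n →L[ℝ] Eu n)) y :=
      hy.hasFDerivAt.comp y R.toContinuousLinearEquiv.hasFDerivAt
    rw [h2.fderiv]
    rfl
  have h3 : DifferentiableAt ℝ (fun z => fderiv ℝ f z (R e)) (R x) :=
    hf.differentiableAt_fderiv.clm_apply (differentiableAt_const _)
  have h4 : HasFDerivAt (fun y => (fun z => fderiv ℝ f z (R e)) (R y))
      ((fderiv ℝ (fun z => fderiv ℝ f z (R e)) (R x)).comp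
        (R.toContinuousLinearEquiv : Eu n →L[ℝ] Eu n)) x :=
    h3.hasFDerivAt.comp x R.toContinuousLinearEquiv.hasFDerivAt
  rw [h1.fderiv_eq, h4.fderiv, iteratedFDeriv_two_apply]
  have := fderiv_fderiv_apply hf (R e)
  simp only [ContinuousLinearMap.comp_apply, ContinuousLinearEquiv.coe_coe]
  simpa [e] using this

lemma fderiv_comp_isometry (R : Eu n ≃ₗᵢ[ℝ] Eu n) (hf : DifferentiableAt ℝ f (R x)) (v : Eu n) :
    fderiv ℝ (fun y => f (R y)) x v = fderiv ℝ f (R x) (R v) := by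
  have h2 : HasFDerivAt (fun y => f (R y))
      ((fderiv ℝ f (R x)).comp (R.toContinuousLinearEquiv : Eu n →L[ℝ] Eu n)) x :=
    hf.hasFDerivAt.comp x R.toContinuousLinearEquiv.hasFDerivAt
  rw [h2.fderiv]
  rfl

lemma lapl_nonpos_of_isLocalMax (hf : ContDiffAt ℝ 2 f x) (hm : IsLocalMax f x) :
    lapl f x ≤ 0 := by
  unfold lapl
  refine Finset.sum_nonpos fun i _ => ?_
  set e : Eu n := EuclideanSpace.single i 1
  by_contra! hpos
  rw [fderiv_fderiv_apply hf] at hpos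
  set l : ℝ → Eu n := fun t => x + t • e
  have hl : ∀ t, HasDerivAt l e t := fun t => by
    have := ((hasDerivAt_id t).smul_const e).const_add x
    rw [one_smul] at this
    exact this
  have hl0 : l 0 = x := by simp [l]
  have hlc : Tendsto l (𝓝 0) (𝓝 x) := by
    have := (hl 0).continuousAt.tendsto
    rwa [hl0] at this
  set F : ℝ → ℝ := fun t => f (l t)
  have hF1 : ∀ᶠ t in 𝓝 0, deriv F t = fderiv ℝ f (l t) e := by
    filter_upwards [hlc.eventually hf.eventually_differentiableAt] with t ht
    exact (ht.hasFDerivAt.comp_hasDerivAt t (hl t)).deriv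
  have hF2 : deriv (deriv F) 0 = fderiv ℝ (fderiv ℝ f) x e e := by
    have hF1' : deriv F =ᶠ[𝓝 0] fun t => fderiv ℝ f (l t) e := hF1
    rw [hF1'.deriv_eq]
    have h3 : HasFDerivAt (fun z => fderiv ℝ f z e)
        (fderiv ℝ (fun z => fderiv ℝ f z e) (l 0)) (l 0) := by
      rw [hl0]
      exact (hf.differentiableAt_fderiv.clm_apply (differentiableAt_const _)).hasFDerivAt
    have := (h3.comp_hasDerivAt 0 (hl 0)).deriv
    rw [hl0, fderiv_fderiv_apply hf] at this
    exact this
  have hmax : IsLocalMax F 0 := by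
    have : ∀ᶠ t in 𝓝 0, f (l t) ≤ f x := hlc.eventually hm
    filter_upwards [this] with t ht
    simpa [F, hl0] using ht
  have hcont : ContinuousAt F 0 := by
    have h := hf.continuousAt
    rw [← hl0] at h
    exact ContinuousAt.comp (f := l) h (hl 0).continuousAt
  have hmin : IsLocalMin F 0 := isLocalMin_of_deriv_deriv_pos (by rw [hF2]; exact hpos)
    hmax.deriv_eq_zero hcont
  have hconst : F =ᶠ[𝓝 0] fun _ => F 0 := by
    filter_upwards [hmax, hmin] with t h1 h2 using le_antisymm h1 h2
  have : deriv (deriv F) 0 = 0 := by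
    have h5 : deriv F =ᶠ[𝓝 0] fun _ => 0 := by
      filter_upwards [hconst.eventuallyEq_nhds] with t ht
      rw [ht.deriv_eq]; simp
    rw [h5.deriv_eq]; simp
  rw [hF2] at this
  exact hpos.ne' this

/-- Coordinates of a linear functional paired with the coordinates of a vector. -/
lemma sum_apply_single (L : Eu n →L[ℝ] ℝ) (x : Eu n) :
    ∑ i, x i * L (EuclideanSpace.single i 1) = L x := by
  conv_rhs => rw [← (EuclideanSpace.basisFun (Fin n) ℝ).sum_repr x]
  simp

lemma contDiffAt_norm_rpow (hx : x ≠ 0) (κ : ℝ) :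
    ContDiffAt ℝ 2 (fun y : Eu n => ‖y‖ ^ κ) x :=
  (contDiffAt_norm ℝ hx).rpow_const_of_ne (norm_ne_zero_iff.2 hx)

lemma hasFDerivAt_norm_rpow_of_ne (hx : x ≠ 0) (κ : ℝ) :
    HasFDerivAt (fun y : Eu n => ‖y‖ ^ κ) ((κ * ‖x‖ ^ (κ - 2)) • innerSL ℝ x) x := by
  have h := ((hasStrictFDerivAt_norm_sq x).hasFDerivAt).rpow_const (p := κ / 2)
    (Or.inl (by simpa using hx))
  have he : (fun y : Eu n => (‖y‖ ^ 2) ^ (κ / 2)) = fun y => ‖y‖ ^ κ := by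
    funext y
    rw [← Real.rpow_natCast, ← Real.rpow_mul (norm_nonneg _)]
    congr 1
    push_cast; ring
  rw [he] at h
  have hc : (κ / 2 * (‖x‖ ^ 2) ^ (κ / 2 - 1)) • 2 • innerSL ℝ x
      = (κ * ‖x‖ ^ (κ - 2)) • innerSL ℝ x := by
    rw [← Real.rpow_natCast, ← Real.rpow_mul (norm_nonneg _), ← Nat.cast_smul_eq_nsmul ℝ,
      smul_smul]
    congr 1
    rw [show ((2 : ℕ) : ℝ) * (κ / 2 - 1) = κ - 2 by push_cast; ring]
    push_cast; ring
  rw [← hc]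
  exact h

lemma lapl_norm_rpow (hx : x ≠ 0) (κ : ℝ) :
    lapl (fun y : Eu n => ‖y‖ ^ κ) x = κ * (κ + n - 2) * ‖x‖ ^ (κ - 2) := by
  have hpos : 0 < ‖x‖ := norm_pos_iff.2 hx
  have key : ∀ i : Fin n, fderiv ℝ (fun y => fderiv ℝ (fun y : Eu n => ‖y‖ ^ κ) y
      (EuclideanSpace.single i 1)) x (EuclideanSpace.single i 1)
      = κ * (κ - 2) * ‖x‖ ^ (κ - 4) * (x i) ^ 2 + κ * ‖x‖ ^ (κ - 2) := by
    intro i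
    have h1 : (fun y => fderiv ℝ (fun y : Eu n => ‖y‖ ^ κ) y (EuclideanSpace.single i 1))
        =ᶠ[𝓝 x] fun y => κ * ‖y‖ ^ (κ - 2) * y i := by
      filter_upwards [isOpen_ne.mem_nhds hx] with y hy
      rw [(hasFDerivAt_norm_rpow_of_ne hy κ).fderiv]
      simp [EuclideanSpace.inner_single_right]
    have h2 : HasFDerivAt (fun y : Eu n => y i) (EuclideanSpace.proj i : Eu n →L[ℝ] ℝ) x :=
      (EuclideanSpace.proj i : Eu n →L[ℝ] ℝ).hasFDerivAt
    have h3 := ((hasFDerivAt_norm_rpow_of_ne hx (κ - 2)).const_mul κ).fun_mul h2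
    rw [h1.fderiv_eq, h3.fderiv]
    simp [EuclideanSpace.inner_single_right]
    rw [show κ - 2 - 2 = κ - 4 by ring]
    ring
  unfold lapl
  rw [Finset.sum_congr rfl fun i _ => key i, Finset.sum_add_distrib, ← Finset.mul_sum,
    ← EuclideanSpace.real_norm_sq_eq]
  have h4 : ‖x‖ ^ (κ - 4) * ‖x‖ ^ 2 = ‖x‖ ^ (κ - 2) := by
    rw [← Real.rpow_natCast, ← Real.rpow_add hpos]; congr 1; push_cast; ring
  rw [mul_assoc, h4]
  simp
  ring

lemma lapl_norm_rpow_mul (hx : x ≠ 0) (κ : ℝ) (hf : ContDiffAt ℝ 2 f x) :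
    lapl (fun y => ‖y‖ ^ κ * f y) x = ‖x‖ ^ κ * (lapl f x + 2 * κ * fderiv ℝ f x x / ‖x‖ ^ 2
      + κ * (κ + n - 2) * f x / ‖x‖ ^ 2) := by
  have hpos : 0 < ‖x‖ := norm_pos_iff.2 hx
  rw [lapl_mul (contDiffAt_norm_rpow hx κ) hf, lapl_norm_rpow hx,
    (hasFDerivAt_norm_rpow_of_ne hx κ).fderiv]
  have h1 : ∑ i, ((κ * ‖x‖ ^ (κ - 2)) • innerSL ℝ x) (EuclideanSpace.single i (1:ℝ)) *
      fderiv ℝ f x (EuclideanSpace.single i 1) = κ * ‖x‖ ^ (κ - 2) * fderiv ℝ f x x := by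
    rw [← sum_apply_single (fderiv ℝ f x) x, Finset.mul_sum]
    refine Finset.sum_congr rfl fun i _ => ?_
    simp [EuclideanSpace.inner_single_right]
    ring
  have h4 : ‖x‖ ^ (κ - 2) = ‖x‖ ^ κ / ‖x‖ ^ 2 := by
    rw [Real.rpow_sub hpos]; norm_num
  rw [h1, h4]
  field_simp
  ring

lemma fderiv_norm_rpow_mul (hx : x ≠ 0) (κ : ℝ) (hf : DifferentiableAt ℝ f x) :
    fderiv ℝ (fun y => ‖y‖ ^ κ * f y) x x = ‖x‖ ^ κ * (fderiv ℝ f x x + κ * f x) := by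
  have hpos : 0 < ‖x‖ := norm_pos_iff.2 hx
  rw [((hasFDerivAt_norm_rpow_of_ne hx κ).fun_mul hf.hasFDerivAt).fderiv]
  have h4 : ‖x‖ ^ (κ - 2) = ‖x‖ ^ κ / ‖x‖ ^ 2 := by
    rw [Real.rpow_sub hpos]; norm_num
  simp [h4]
  field_simp

/-- The Laplacian of the cylinder `ℝ × Sⁿ⁻¹` in the coordinate `x = e^t θ`. -/
def cylLapl (w : Eu n → ℝ) (x : Eu n) : ℝ :=
  ‖x‖ ^ 2 * lapl w x + (2 - n) * fderiv ℝ w x x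

lemma cylLapl_add (hf : ContDiffAt ℝ 2 f x) (hg : ContDiffAt ℝ 2 g x) :
    cylLapl (fun y => f y + g y) x = cylLapl f x + cylLapl g x := by
  unfold cylLapl
  rw [lapl_add hf hg, fderiv_fun_add (hf.differentiableAt (by simp))
    (hg.differentiableAt (by simp))]
  simp only [add_apply]
  ring

lemma cylLapl_const_mul (hf : ContDiffAt ℝ 2 f x) (c : ℝ) :
    cylLapl (fun y => c * f y) x = c * cylLapl f x := by
  unfold cylLapl
  rw [lapl_const_mul hf c, fderiv_const_mul (hf.differentiableAt (by simp))]
  simp only [smul_apply, smul_eq_mul]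
  ring

lemma cylLapl_sub (hf : ContDiffAt ℝ 2 f x) (hg : ContDiffAt ℝ 2 g x) :
    cylLapl (fun y => f y - g y) x = cylLapl f x - cylLapl g x := by
  have h := cylLapl_add hf (contDiffAt_const (c := (-1:ℝ)) |>.mul hg)
  rw [cylLapl_const_mul hg] at h
  have he : (fun y => f y - g y) = fun y => f y + -1 * g y := by funext y; ring
  rw [he]
  linarith

lemma cylLapl_norm_rpow_mul (hx : x ≠ 0) (κ : ℝ) (hf : ContDiffAt ℝ 2 f x) :
    cylLapl (fun y => ‖y‖ ^ κ * f y) x = ‖x‖ ^ κ * (‖x‖ ^ 2 * lapl f x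
      + (2 - n + 2 * κ) * fderiv ℝ f x x + κ ^ 2 * f x) := by
  have hpos : 0 < ‖x‖ := norm_pos_iff.2 hx
  unfold cylLapl
  rw [lapl_norm_rpow_mul hx κ hf, fderiv_norm_rpow_mul hx κ (hf.differentiableAt (by simp))]
  field_simp
  ring

lemma cylLapl_norm_rpow (hx : x ≠ 0) (κ : ℝ) :
    cylLapl (fun y : Eu n => ‖y‖ ^ κ) x = κ ^ 2 * ‖x‖ ^ κ := by
  have h := cylLapl_norm_rpow_mul (f := fun _ => 1) hx κ contDiffAt_const
  have : lapl (fun _ : Eu n => (1 : ℝ)) x = 0 := by simp [lapl]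
  simp [this] at h
  rw [h]; ring

lemma cylLapl_comp_isometry (R : Eu n ≃ₗᵢ[ℝ] Eu n) (hf : ContDiffAt ℝ 2 f (R x)) :
    cylLapl (fun y => f (R y)) x = cylLapl f (R x) := by
  unfold cylLapl
  rw [lapl_comp_isometry R hf, fderiv_comp_isometry R (hf.differentiableAt (by simp)), R.norm_map]

lemma cylLapl_nonpos_of_isLocalMax (hf : ContDiffAt ℝ 2 f x) (hm : IsLocalMax f x) :
    cylLapl f x ≤ 0 := by
  unfold cylLapl
  rw [hm.fderiv_eq_zero]
  have := lapl_nonpos_of_isLocalMax hf hm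
  have h2 : 0 ≤ ‖x‖ ^ 2 := by positivity
  simp only [zero_apply, mul_zero, add_zero]
  exact mul_nonpos_of_nonneg_of_nonpos h2 this

end Laplacian

section Comparison

variable {n : ℕ}

/-- Maximum principle for the cylindrical Laplacian on a compact set. -/
lemma nonpos_of_cylLapl_pos {K : Set (Eu n)} {W : Eu n → ℝ} (hK : IsCompact K)
    (hc : ContinuousOn W K)
    (h : ∀ x ∈ K, 0 < W x → K ∈ 𝓝 x ∧ ContDiffAt ℝ 2 W x ∧ 0 < cylLapl W x) :
    ∀ x ∈ K, W x ≤ 0 := by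
  intro x hx
  obtain ⟨m, hm, hmax⟩ := hK.exists_isMaxOn ⟨x, hx⟩ hc
  by_contra! hpos
  have hWm : 0 < W m := hpos.trans_le (hmax hx)
  obtain ⟨h1, h2, h3⟩ := h m hm hWm
  exact absurd (cylLapl_nonpos_of_isLocalMax h2 (hmax.isLocalMax h1)) (not_le.2 h3)

lemma norm_rpow_mul_eq (x : Eu n) (s l : ℝ) : ‖x‖ ^ (s * l) = (‖x‖ ^ s) ^ l :=
  Real.rpow_mul (norm_nonneg _) _ _

lemma norm_rpow_pos {x : Eu n} (hx : x ≠ 0) (s : ℝ) : 0 < ‖x‖ ^ s :=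
  Real.rpow_pos_of_pos (norm_pos_iff.2 hx) _

lemma isCompact_norm_rpow_mem_Icc {s : ℝ} (hs : s = 1 ∨ s = -1) {r ρ : ℝ} (hr : 0 < r)
    (hrρ : r ≤ ρ) : IsCompact {x : Eu n | x ≠ 0 ∧ r ≤ ‖x‖ ^ s ∧ ‖x‖ ^ s ≤ ρ} := by
  have key : ∀ r' ρ' : ℝ, 0 < r' → IsCompact {x : Eu n | r' ≤ ‖x‖ ∧ ‖x‖ ≤ ρ'} := by
    intro r' ρ' hr'
    refine Metric.isCompact_of_isClosed_isBounded ?_ ?_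
    · exact (isClosed_le continuous_const continuous_norm).inter
        (isClosed_le continuous_norm continuous_const)
    · refine (Metric.isBounded_closedBall (x := (0 : Eu n)) (r := ρ')).subset ?_
      intro x hx
      simpa using hx.2
  have hρ : 0 < ρ := hr.trans_le hrρ
  rcases hs with rfl | rfl
  · convert key r ρ hr using 1
    ext x
    simp only [Real.rpow_one, Set.mem_ofPred_eq]
    exact ⟨fun h => h.2, fun h => ⟨norm_pos_iff.1 (hr.trans_le h.1), h⟩⟩
  · convert key ρ⁻¹ r⁻¹ (by positivity) using 1
    ext x
    simp only [Real.rpow_neg_one, Set.mem_ofPred_eq]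
    constructor
    · rintro ⟨h0, h1, h2⟩
      have := norm_pos_iff.2 h0
      exact ⟨inv_le_of_inv_le₀ this h2, (le_inv_comm₀ hr this).1 h1⟩
    · rintro ⟨h1, h2⟩
      have h3 : 0 < ‖x‖ := lt_of_lt_of_le (by positivity) h1
      exact ⟨norm_pos_iff.1 h3, (le_inv_comm₀ hr h3).2 h2, inv_le_of_inv_le₀ hρ h1⟩

/-- Comparison near an end of the cylinder (`s = 1`: near the origin, `s = -1`: near infinity),
possibly restricted to the part where `ℓ ≥ 0`. -/
lemma nonpos_of_mul_lt_cylLapl {s : ℝ} (hs : s = 1 ∨ s = -1) {ρ μ C : ℝ} (hμ : 0 < μ)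
    {ℓ V : Eu n → ℝ} (hℓ : Continuous ℓ) (hV : ∀ x, x ≠ 0 → ContDiffAt ℝ 2 V x)
    (hC : ∀ x, x ≠ 0 → ‖x‖ ^ s ≤ ρ → 0 ≤ ℓ x → V x ≤ C)
    (hρ : ∀ x, x ≠ 0 → ‖x‖ ^ s = ρ → 0 ≤ ℓ x → V x ≤ 0)
    (hℓ0 : ∀ x, x ≠ 0 → ‖x‖ ^ s ≤ ρ → ℓ x = 0 → V x ≤ 0)
    (hsub : ∀ x, x ≠ 0 → ‖x‖ ^ s ≤ ρ → 0 < ℓ x → 0 < V x → μ ^ 2 * V x < cylLapl V x) :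
    ∀ x, x ≠ 0 → ‖x‖ ^ s ≤ ρ → 0 ≤ ℓ x → V x ≤ 0 := by
  intro x hx hxρ hxℓ
  have hs2 : s ^ 2 = 1 := by rcases hs with rfl | rfl <;> norm_num
  by_contra! hpos
  have hQ := norm_rpow_pos hx s
  have hqm : 0 < ‖x‖ ^ (s * (-μ)) := norm_rpow_pos hx _
  set ε := V x / ‖x‖ ^ (s * (-μ)) / 2 with hε
  have hεpos : 0 < ε := by positivity
  have hCpos : 0 < C := hpos.trans_le (hC x hx hxρ hxℓ)
  set r := min (‖x‖ ^ s) ((C / ε) ^ (-(1 / μ))) with hr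
  have hrpos : 0 < r := lt_min hQ (by positivity)
  have hrx : r ≤ ‖x‖ ^ s := min_le_left _ _
  have hCr : C ≤ ε * r ^ (-μ) := by
    have h1 : ((C / ε) ^ (-(1 / μ))) ^ (-μ) ≤ r ^ (-μ) :=
      Real.rpow_le_rpow_of_nonpos hrpos (min_le_right _ _) (by linarith)
    rw [← Real.rpow_mul (by positivity), show -(1 / μ) * -μ = 1 by field_simp, Real.rpow_one] at h1
    rwa [div_le_iff₀' hεpos] at h1
  set W : Eu n → ℝ := fun y => V y - ε * ‖y‖ ^ (s * (-μ)) with hW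
  set K : Set (Eu n) := {y | y ≠ 0 ∧ r ≤ ‖y‖ ^ s ∧ ‖y‖ ^ s ≤ ρ} ∩ {y | 0 ≤ ℓ y} with hKdef
  have hK : IsCompact K := (isCompact_norm_rpow_mem_Icc hs hrpos (hrx.trans hxρ)).inter_right
    (isClosed_le continuous_const hℓ)
  have hWd : ∀ y, y ≠ 0 → ContDiffAt ℝ 2 W y := fun y hy =>
    (hV y hy).sub (contDiffAt_const.mul (contDiffAt_norm_rpow hy _))
  have hWx : W x ≤ 0 := by
    refine nonpos_of_cylLapl_pos hK (fun y hy => (hWd y hy.1.1).continuousAt.continuousWithinAt)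
      ?_ x ⟨⟨hx, hrx, hxρ⟩, hxℓ⟩
    rintro y ⟨⟨hy0, hyr, hyρ⟩, hyℓ⟩ hWy
    have hyq : 0 < ‖y‖ ^ (s * (-μ)) := norm_rpow_pos hy0 _
    have hVy : 0 < V y := by
      have : 0 < ε * ‖y‖ ^ (s * (-μ)) := by positivity
      simp only [hW] at hWy
      linarith
    simp only [Set.mem_ofPred_eq] at hyℓ
    have h1 : ‖y‖ ^ s < ρ := lt_of_le_of_ne hyρ fun h => absurd (hρ y hy0 h hyℓ) (not_le.2 hVy)
    have h2 : 0 < ℓ y := lt_of_le_of_ne hyℓ fun h =>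
      absurd (hℓ0 y hy0 hyρ h.symm) (not_le.2 hVy)
    have h3 : r < ‖y‖ ^ s := by
      refine lt_of_le_of_ne hyr fun h => ?_
      have h4 := hC y hy0 hyρ hyℓ
      have h5 : ‖y‖ ^ (s * (-μ)) = r ^ (-μ) := by rw [norm_rpow_mul_eq, h]
      simp only [hW, h5] at hWy
      linarith
    have hcont : ContinuousAt (fun z : Eu n => ‖z‖ ^ s) y :=
      (contDiffAt_norm_rpow hy0 s).continuousAt
    refine ⟨?_, hWd y hy0, ?_⟩
    · filter_upwards [isOpen_ne.mem_nhds hy0, hcont.eventually_lt_const h1,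
        hcont.eventually_const_lt h3, hℓ.continuousAt.eventually_const_lt h2] with z z1 z2 z3 z4
      exact ⟨⟨z1, z3.le, z2.le⟩, le_of_lt z4⟩
    · have h6 := hsub y hy0 hyρ h2 hVy
      have h7 : cylLapl W y = cylLapl V y - ε * (μ ^ 2 * ‖y‖ ^ (s * (-μ))) := by
        rw [hW, cylLapl_sub (hV y hy0) (contDiffAt_const.mul (contDiffAt_norm_rpow hy0 _)),
          cylLapl_const_mul (contDiffAt_norm_rpow hy0 _), cylLapl_norm_rpow hy0]
        rw [mul_pow, hs2]
        ring
      rw [h7]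
      have h8 : 0 < μ ^ 2 * W y := by positivity
      simp only [hW] at h8
      nlinarith
  have : ε * ‖x‖ ^ (s * (-μ)) = V x / 2 := by
    rw [hε]; field_simp
  simp only [hW, this] at hWx
  linarith

/-- A small positive subsolution of the cylindrical equation decays at the optimal rate. -/
lemma exists_le_mul_norm_rpow {s : ℝ} (hs : s = 1 ∨ s = -1) {γ p C : ℝ} (hγ : 0 < γ)
    (hp : 2 < p) (hC : 0 < C) {Y : Eu n → ℝ} (hY : ∀ x, x ≠ 0 → ContDiffAt ℝ 2 Y x)
    (hpos : ∀ x, x ≠ 0 → 0 < Y x)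
    (hsub : ∀ x, x ≠ 0 → γ ^ 2 * Y x - C * Y x ^ (p - 1) ≤ cylLapl Y x)
    (hlim : ∀ η > 0, ∃ ρ > 0, ∀ x, x ≠ 0 → ‖x‖ ^ s ≤ ρ → Y x ≤ η) :
    ∃ A > 0, ∃ ρ > 0, ∀ x, x ≠ 0 → ‖x‖ ^ s ≤ ρ → Y x ≤ A * ‖x‖ ^ (s * γ) := by
  have hs2 : s ^ 2 = 1 := by rcases hs with rfl | rfl <;> norm_num
  set l := 2 * γ / p with hl
  have hlpos : 0 < l := by positivity
  have hlγ : l < γ := by rw [hl, div_lt_iff₀ (by linarith)]; nlinarith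
  set κ := l * (p - 1) with hκ
  have hγκ : γ < κ := by
    rw [hκ, hl, div_mul_eq_mul_div, lt_div_iff₀ (by linarith)]; nlinarith
  have hsq : 0 < γ ^ 2 - l ^ 2 := by nlinarith
  set η := ((γ ^ 2 - l ^ 2) / (2 * C)) ^ (1 / (p - 2)) with hη
  have hηpos : 0 < η := by positivity
  have hηp : C * η ^ (p - 2) = (γ ^ 2 - l ^ 2) / 2 := by
    rw [hη, ← Real.rpow_mul (by positivity), one_div_mul_cancel (by linarith), Real.rpow_one]
    field_simp
  obtain ⟨ρ, hρ, hYη⟩ := hlim η hηpos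
  have hpw : ∀ t : ℝ, 0 < t → t ^ (p - 1) = t ^ (p - 2) * t := fun t ht => by
    rw [← Real.rpow_add_one ht.ne']; congr 1; ring
  set A₁ := η * ρ ^ (-l) with hA₁
  have hA₁pos : 0 < A₁ := by positivity
  have first : ∀ x, x ≠ 0 → ‖x‖ ^ s ≤ ρ → Y x ≤ A₁ * ‖x‖ ^ (s * l) := by
    intro x hx hxρ
    have hVd : ∀ x, x ≠ 0 → ContDiffAt ℝ 2 (fun x => Y x - A₁ * ‖x‖ ^ (s * l)) x := fun y hy =>
      (hY y hy).sub (contDiffAt_const.mul (contDiffAt_norm_rpow hy _))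
    have := nonpos_of_mul_lt_cylLapl (ℓ := fun _ => 1) (C := η) (ρ := ρ) hs hlpos
      continuous_const hVd ?_ ?_ ?_ ?_ x hx hxρ zero_le_one
    · linarith
    · intro y hy hyρ _
      have : 0 < A₁ * ‖y‖ ^ (s * l) := mul_pos hA₁pos (norm_rpow_pos hy _)
      linarith [hYη y hy hyρ]
    · intro y hy hyρ _
      have : A₁ * ‖y‖ ^ (s * l) = η := by
        rw [norm_rpow_mul_eq, hyρ, hA₁, mul_assoc, ← Real.rpow_add hρ]; simp
      rw [this]
      linarith [hYη y hy hyρ.le]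
    · intro y hy hyρ h; norm_num at h
    · intro y hy hyρ _ hV
      rw [cylLapl_sub (hY y hy) (contDiffAt_const.mul (contDiffAt_norm_rpow hy _)),
          cylLapl_const_mul (contDiffAt_norm_rpow hy _), cylLapl_norm_rpow hy, mul_pow, hs2]
      have hYp := hpos y hy
      have h1 := hsub y hy
      have h2 : C * Y y ^ (p - 1) ≤ (γ ^ 2 - l ^ 2) / 2 * Y y := by
        rw [hpw _ hYp, ← hηp, ← mul_assoc]
        have : Y y ^ (p - 2) ≤ η ^ (p - 2) :=
          Real.rpow_le_rpow hYp.le (hYη y hy hyρ) (by linarith)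
        gcongr
      have h3 : 0 < (γ ^ 2 - l ^ 2) * Y y := by positivity
      linarith
  set D := (C * A₁ ^ (p - 1) + 1) / (κ ^ 2 - γ ^ 2) with hD
  have hκsq : 0 < κ ^ 2 - γ ^ 2 := by nlinarith
  have hDpos : 0 < D := by positivity
  set A := (η + D * ρ ^ κ) * ρ ^ (-γ) with hA
  have hApos : 0 < A := by positivity
  refine ⟨A, hApos, ρ, hρ, fun x hx hxρ => ?_⟩
  have hκpos : 0 < κ := hγ.trans hγκ
  have hVd : ∀ x, x ≠ 0 → ContDiffAt ℝ 2
      (fun x => (Y x - A * ‖x‖ ^ (s * γ)) + D * ‖x‖ ^ (s * κ)) x := fun y hy =>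
    ((hY y hy).sub (contDiffAt_const.mul (contDiffAt_norm_rpow hy _))).add
      (contDiffAt_const.mul (contDiffAt_norm_rpow hy _))
  have hqκ : ∀ y : Eu n, y ≠ 0 → ‖y‖ ^ s ≤ ρ → D * ‖y‖ ^ (s * κ) ≤ D * ρ ^ κ := by
    intro y hy hyρ
    rw [norm_rpow_mul_eq]
    have := Real.rpow_le_rpow (norm_rpow_pos hy s).le hyρ hκpos.le
    gcongr
  have := nonpos_of_mul_lt_cylLapl (ℓ := fun _ => 1) (C := η + D * ρ ^ κ) (ρ := ρ) hs hγ
      continuous_const hVd ?_ ?_ ?_ ?_ x hx hxρ zero_le_one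
  · have : 0 < D * ‖x‖ ^ (s * κ) := mul_pos hDpos (norm_rpow_pos hx _)
    linarith
  · intro y hy hyρ _
    have h1 : 0 < A * ‖y‖ ^ (s * γ) := mul_pos hApos (norm_rpow_pos hy _)
    linarith [hYη y hy hyρ, hqκ y hy hyρ]
  · intro y hy hyρ _
    have h1 : A * ‖y‖ ^ (s * γ) = η + D * ρ ^ κ := by
      rw [norm_rpow_mul_eq, hyρ, hA, mul_assoc, ← Real.rpow_add hρ]; simp
    rw [h1]
    linarith [hYη y hy hyρ.le, hqκ y hy hyρ.le]
  · intro y hy hyρ h; norm_num at h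
  · intro y hy hyρ _ hV
    rw [cylLapl_add ((hY y hy).sub (contDiffAt_const.mul (contDiffAt_norm_rpow hy _)))
        (contDiffAt_const.mul (contDiffAt_norm_rpow hy _)),
      cylLapl_sub (hY y hy) (contDiffAt_const.mul (contDiffAt_norm_rpow hy _)),
      cylLapl_const_mul (contDiffAt_norm_rpow hy _), cylLapl_norm_rpow hy,
      cylLapl_const_mul (contDiffAt_norm_rpow hy _), cylLapl_norm_rpow hy, mul_pow, mul_pow, hs2]
    have hYp := hpos y hy
    have h1 := hsub y hy
    have hqp := norm_rpow_pos hy (s * κ)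
    have h2 : C * Y y ^ (p - 1) ≤ C * A₁ ^ (p - 1) * ‖y‖ ^ (s * κ) := by
      have h3 : Y y ^ (p - 1) ≤ (A₁ * ‖y‖ ^ (s * l)) ^ (p - 1) :=
        Real.rpow_le_rpow hYp.le (first y hy hyρ) (by linarith)
      rw [Real.mul_rpow hA₁pos.le (norm_rpow_pos hy _).le, ← Real.rpow_mul (norm_nonneg _),
        mul_assoc s, ← hκ] at h3
      rw [mul_assoc]
      gcongr
    have h4 : D * (κ ^ 2 - γ ^ 2) * ‖y‖ ^ (s * κ) = (C * A₁ ^ (p - 1) + 1) * ‖y‖ ^ (s * κ) := by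
      rw [hD, div_mul_cancel₀ _ hκsq.ne']
    nlinarith

/-- Minima over spheres of the rescaled supersolution propagate towards the end. -/
lemma mul_norm_rpow_le_of_sphere {s : ℝ} (hs : s = 1 ∨ s = -1) {γ ρ c : ℝ} (hγ : 0 < γ)
    (hc : 0 ≤ c) {w : Eu n → ℝ} (hw : ∀ x, x ≠ 0 → ContDiffAt ℝ 2 w x)
    (hpos : ∀ x, x ≠ 0 → 0 < w x) (hsup : ∀ x, x ≠ 0 → cylLapl w x < γ ^ 2 * w x)
    (hb : ∀ y, y ≠ 0 → ‖y‖ ^ s = ρ → c * ‖y‖ ^ (s * γ) ≤ w y) :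
    ∀ y, y ≠ 0 → ‖y‖ ^ s ≤ ρ → c * ‖y‖ ^ (s * γ) ≤ w y := by
  intro x hx hxρ
  have hs2 : s ^ 2 = 1 := by rcases hs with rfl | rfl <;> norm_num
  have hVd : ∀ x, x ≠ 0 → ContDiffAt ℝ 2 (fun x => c * ‖x‖ ^ (s * γ) - w x) x := fun y hy =>
    (contDiffAt_const.mul (contDiffAt_norm_rpow hy _)).sub (hw y hy)
  have := nonpos_of_mul_lt_cylLapl (ℓ := fun _ => 1) (C := c * ρ ^ γ) (ρ := ρ) hs hγ
      continuous_const hVd ?_ ?_ ?_ ?_ x hx hxρ zero_le_one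
  · linarith
  · intro y hy hyρ _
    have h1 := Real.rpow_le_rpow (norm_rpow_pos hy s).le hyρ hγ.le
    rw [← norm_rpow_mul_eq] at h1
    have h2 : c * ‖y‖ ^ (s * γ) ≤ c * ρ ^ γ := by gcongr
    linarith [hpos y hy]
  · intro y hy hyρ _
    linarith [hb y hy hyρ]
  · intro y hy hyρ h; norm_num at h
  · intro y hy hyρ _ hV
    rw [cylLapl_sub (contDiffAt_const.mul (contDiffAt_norm_rpow hy _)) (hw y hy),
      cylLapl_const_mul (contDiffAt_norm_rpow hy _), cylLapl_norm_rpow hy, mul_pow, hs2]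
    have := hsup y hy
    linarith

end Comparison

section Asymptotics

variable {n : ℕ}

lemma lapl_inner (ξ x : Eu n) : lapl (fun y : Eu n => inner ℝ ξ y) x = 0 := by
  have h : ∀ y : Eu n, fderiv ℝ (fun y : Eu n => inner ℝ ξ y) y = innerSL ℝ ξ := fun y =>
    (innerSL ℝ ξ).fderiv
  simp [lapl, h]

lemma fderiv_inner_self (ξ x : Eu n) :
    fderiv ℝ (fun y : Eu n => inner ℝ ξ y) x x = inner ℝ ξ x := by
  have h : fderiv ℝ (fun y : Eu n => inner ℝ ξ y) x = innerSL ℝ ξ := (innerSL ℝ ξ).fderiv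
  rw [h]; rfl

lemma contDiffAt_inner_left (ξ x : Eu n) : ContDiffAt ℝ 2 (fun y : Eu n => inner ℝ ξ y) x :=
  (innerSL ℝ ξ).contDiff.contDiffAt

lemma sum_inner_single_sq (ξ : Eu n) :
    ∑ i, (inner ℝ ξ (EuclideanSpace.single i (1:ℝ)) : ℝ) ^ 2 = ‖ξ‖ ^ 2 := by
  rw [EuclideanSpace.real_norm_sq_eq]
  simp [EuclideanSpace.inner_single_right]

/-- A barrier on the half space `{⟨ξ, x⟩ ≥ 0}`. -/
def halfBarrier (k : ℝ) (ξ x : Eu n) : ℝ :=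
  ‖x‖ ^ k + 3 * (‖x‖ ^ (k - 1) * inner ℝ ξ x) - ‖x‖ ^ (k - 2) * (inner ℝ ξ x * inner ℝ ξ x)

lemma contDiffAt_halfBarrier (k : ℝ) (ξ : Eu n) {x : Eu n} (hx : x ≠ 0) :
    ContDiffAt ℝ 2 (halfBarrier k ξ) x :=
  ((contDiffAt_norm_rpow hx k).add (contDiffAt_const.mul ((contDiffAt_norm_rpow hx _).mul
    (contDiffAt_inner_left ξ x)))).sub ((contDiffAt_norm_rpow hx _).mul
    ((contDiffAt_inner_left ξ x).mul (contDiffAt_inner_left ξ x)))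

lemma cylLapl_halfBarrier (k : ℝ) {ξ : Eu n} (hξ : ‖ξ‖ = 1) {x : Eu n} (hx : x ≠ 0) :
    cylLapl (halfBarrier k ξ) x = k ^ 2 * halfBarrier k ξ x
      - 3 * (n - 1) * (‖x‖ ^ (k - 1) * inner ℝ ξ x) - 2 * ‖x‖ ^ k
      + 2 * n * (‖x‖ ^ (k - 2) * (inner ℝ ξ x * inner ℝ ξ x)) := by
  have hl := contDiffAt_inner_left ξ x
  have hld := hl.differentiableAt (by simp)
  have h1 := (contDiffAt_norm_rpow hx (k - 1)).mul hl
  have h2 := (contDiffAt_norm_rpow hx (k - 2)).mul (hl.mul hl)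
  have hpos : 0 < ‖x‖ := norm_pos_iff.2 hx
  have h4 : ‖x‖ ^ (k - 2) = ‖x‖ ^ k / ‖x‖ ^ 2 := by
    rw [Real.rpow_sub hpos]; norm_num
  have hfd : ∀ i : Fin n, fderiv ℝ (fun y : Eu n => inner ℝ ξ y) x (EuclideanSpace.single i 1)
      = inner ℝ ξ (EuclideanSpace.single i (1:ℝ)) := fun i => by
    have h : fderiv ℝ (fun y : Eu n => inner ℝ ξ y) x = innerSL ℝ ξ := (innerSL ℝ ξ).fderiv
    rw [h]; rfl
  have hlap : lapl (fun y : Eu n => inner ℝ ξ y * inner ℝ ξ y) x = 2 := by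
    rw [lapl_mul hl hl, lapl_inner]
    simp only [hfd, ← pow_two, sum_inner_single_sq, hξ]
    norm_num
  have hfd2 : fderiv ℝ (fun y : Eu n => inner ℝ ξ y * inner ℝ ξ y) x x
      = 2 * (inner ℝ ξ x * inner ℝ ξ x) := by
    rw [fderiv_fun_mul hld hld]
    simp only [add_apply, smul_apply, smul_eq_mul, fderiv_inner_self]
    ring
  unfold halfBarrier
  rw [cylLapl_sub ((contDiffAt_norm_rpow hx k).add (contDiffAt_const.mul h1)) h2,
    cylLapl_add (contDiffAt_norm_rpow hx k) (contDiffAt_const.mul h1), cylLapl_const_mul h1,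
    cylLapl_norm_rpow hx, cylLapl_norm_rpow_mul hx _ hl, cylLapl_norm_rpow_mul hx _ (hl.mul hl),
    lapl_inner, fderiv_inner_self, hlap, hfd2, h4]
  field_simp
  ring

lemma halfBarrier_bounds (hn : 3 ≤ n) (k : ℝ) {ξ : Eu n} (hξ : ‖ξ‖ = 1) {x : Eu n} (hx : x ≠ 0)
    (hℓ : 0 ≤ (inner ℝ ξ x : ℝ)) :
    ‖x‖ ^ k ≤ halfBarrier k ξ x ∧ halfBarrier k ξ x ≤ 3 * ‖x‖ ^ k ∧
      cylLapl (halfBarrier k ξ) x ≤ k ^ 2 * halfBarrier k ξ x - 2 * ‖x‖ ^ k := by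
  have hpos : 0 < ‖x‖ := norm_pos_iff.2 hx
  have hn' : (3 : ℝ) ≤ n := by exact_mod_cast hn
  rw [cylLapl_halfBarrier k hξ hx]
  have h4 : ‖x‖ ^ (k - 2) = ‖x‖ ^ k / ‖x‖ ^ 2 := by
    rw [Real.rpow_sub hpos]; norm_num
  have h5 : ‖x‖ ^ (k - 1) = ‖x‖ ^ k / ‖x‖ := by
    rw [Real.rpow_sub hpos]; norm_num
  set t : ℝ := inner ℝ ξ x / ‖x‖ with ht
  have hle : (inner ℝ ξ x : ℝ) ≤ ‖x‖ := by
    have := real_inner_le_norm ξ x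
    rwa [hξ, one_mul] at this
  have ht0 : 0 ≤ t := by positivity
  have ht1 : t ≤ 1 := (div_le_one hpos).2 hle
  have e1 : ‖x‖ ^ (k - 1) * (inner ℝ ξ x : ℝ) = ‖x‖ ^ k * t := by rw [h5, ht]; ring
  have e2 : ‖x‖ ^ (k - 2) * (inner ℝ ξ x * inner ℝ ξ x : ℝ) = ‖x‖ ^ k * t ^ 2 := by
    rw [h4, ht]; ring
  have hP : 0 < ‖x‖ ^ k := Real.rpow_pos_of_pos hpos _
  have e3 : halfBarrier k ξ x = ‖x‖ ^ k * (1 + 3 * t - t ^ 2) := by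
    unfold halfBarrier; rw [e1, e2]; ring
  rw [e1, e2, e3]
  refine ⟨?_, ?_, ?_⟩
  · nlinarith [mul_nonneg hP.le (show 0 ≤ 3 * t - t ^ 2 by nlinarith)]
  · nlinarith [mul_nonneg hP.le (show 0 ≤ 2 - 3 * t + t ^ 2 by nlinarith)]
  · have : 0 ≤ 3 * ((n:ℝ) - 1) * t - 2 * n * t ^ 2 := by
      have : 0 ≤ t * (3 * ((n:ℝ) - 1) - 2 * n * t) := mul_nonneg ht0 (by nlinarith)
      linarith
    nlinarith [mul_nonneg hP.le this]

/-- The oscillation over spheres decays faster than the solution. -/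
lemma exists_sub_le_of_norm_eq (hn : 3 ≤ n) {s : ℝ} (hs : s = 1 ∨ s = -1) {γ κ A C ρ : ℝ}
    (hγ : 0 < γ) (hγκ : γ < κ) (hA : 0 < A) (hC : 0 ≤ C) (hρ : 0 < ρ) (hρ1 : ρ ≤ 1) {w : Eu n → ℝ}
    (hw : ∀ x, x ≠ 0 → ContDiffAt ℝ 2 w x) (hpos : ∀ x, x ≠ 0 → 0 < w x)
    (hwA : ∀ x, x ≠ 0 → ‖x‖ ^ s ≤ ρ → w x ≤ A * ‖x‖ ^ (s * γ))
    (heq : ∀ x, x ≠ 0 → ‖x‖ ^ s ≤ ρ → |cylLapl w x - γ ^ 2 * w x| ≤ C * ‖x‖ ^ (s * κ)) :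
    ∃ τ > 0, ∃ B > 0, ∀ x y, x ≠ 0 → ‖x‖ = ‖y‖ → ‖x‖ ^ s ≤ ρ →
      w y - w x ≤ B * ‖x‖ ^ (s * (γ + τ)) := by
  have hs2 : s ^ 2 = 1 := by rcases hs with rfl | rfl <;> norm_num
  obtain ⟨τ, hτ, hτκ, hτ1⟩ : ∃ τ > 0, γ + τ ≤ κ ∧ 2 * γ * τ + τ ^ 2 ≤ 1 / 3 := by
    refine ⟨min (κ - γ) (min 1 (1 / (3 * (2 * γ + 1)))), ?_, ?_, ?_⟩
    · exact lt_min (by linarith) (lt_min one_pos (by positivity))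
    · linarith [min_le_left (κ - γ) (min 1 (1 / (3 * (2 * γ + 1))))]
    · set m := min (κ - γ) (min 1 (1 / (3 * (2 * γ + 1)))) with hm
      have hm0 : 0 < m := lt_min (by linarith) (lt_min one_pos (by positivity))
      have hm1 : m ≤ 1 := (min_le_right _ _).trans (min_le_left _ _)
      have hm2 : m ≤ 1 / (3 * (2 * γ + 1)) := (min_le_right _ _).trans (min_le_right _ _)
      rw [le_div_iff₀ (by positivity)] at hm2
      nlinarith
  set A' := A * ρ ^ (-τ) + 2 * C + 1 with hA'
  have hA'pos : 0 < A' := by positivity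
  refine ⟨τ, hτ, 3 * A', by positivity, fun x y hx hxy hxρ => ?_⟩
  have hxs : 0 < ‖x‖ ^ (s * (γ + τ)) := norm_rpow_pos hx _
  rcases eq_or_ne x y with rfl | hne
  · rw [sub_self]; positivity
  set ξ : Eu n := ‖x - y‖⁻¹ • (x - y) with hξdef
  have hxy0 : 0 < ‖x - y‖ := norm_pos_iff.2 (sub_ne_zero.2 hne)
  have hξ : ‖ξ‖ = 1 := by
    rw [hξdef, norm_smul, norm_inv, norm_norm, inv_mul_cancel₀ hxy0.ne']
  set R : Eu n ≃ₗᵢ[ℝ] Eu n := (ℝ ∙ (x - y))ᗮ.reflection with hR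
  have hRx : R x = y := Submodule.reflection_sub hxy
  have hR0 : ∀ z, z ≠ 0 → R z ≠ 0 := fun z hz h => hz (by simpa using h)
  set k := s * (γ + τ) with hk
  set V : Eu n → ℝ := fun z => (w (R z) - w z) - A' * halfBarrier k ξ z with hV
  have hwR : ∀ z, z ≠ 0 → ContDiffAt ℝ 2 (fun z => w (R z)) z := fun z hz =>
    (hw _ (hR0 z hz)).comp z R.contDiff.contDiffAt
  have hVd : ∀ z, z ≠ 0 → ContDiffAt ℝ 2 V z := fun z hz =>
    ((hwR z hz).sub (hw z hz)).sub (contDiffAt_const.mul (contDiffAt_halfBarrier k ξ hz))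
  have hℓx : 0 ≤ (inner ℝ ξ x : ℝ) := by
    rw [hξdef, inner_smul_left, inner_sub_left, real_inner_self_eq_norm_sq]
    have := real_inner_le_norm y x
    rw [← hxy] at this
    have h2 : 0 ≤ ‖x‖ ^ 2 - inner ℝ y x := by nlinarith
    simp only [conj_trivial]
    positivity
  have main := nonpos_of_mul_lt_cylLapl (ℓ := fun z => inner ℝ ξ z) (V := V) (C := A * ρ ^ γ)
    (ρ := ρ) hs hγ (by fun_prop) hVd ?_ ?_ ?_ ?_ x hx hxρ hℓx
  · have h := (halfBarrier_bounds hn k hξ hx hℓx).2.1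
    simp only [hV, hRx] at main
    nlinarith
  · intro z hz hzρ hzℓ
    have h1 := (halfBarrier_bounds hn k hξ hz hzℓ).1
    have h2 : 0 < ‖z‖ ^ k := norm_rpow_pos hz _
    have h3 := hwA (R z) (hR0 z hz) (by rwa [R.norm_map])
    rw [R.norm_map, norm_rpow_mul_eq] at h3
    have h4 := Real.rpow_le_rpow (norm_rpow_pos hz s).le hzρ hγ.le
    have h5 : A * (‖z‖ ^ s) ^ γ ≤ A * ρ ^ γ := by gcongr
    have h6 : 0 < A' * halfBarrier k ξ z := mul_pos hA'pos (h2.trans_le h1)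
    simp only [hV]
    linarith [hpos z hz]
  · intro z hz hzρ hzℓ
    have h1 := (halfBarrier_bounds hn k hξ hz hzℓ).1
    have h3 := hwA (R z) (hR0 z hz) (by rw [R.norm_map, hzρ])
    rw [R.norm_map, norm_rpow_mul_eq, hzρ] at h3
    rw [hk, norm_rpow_mul_eq, hzρ] at h1
    have h7 : A * ρ ^ γ ≤ A' * ρ ^ (γ + τ) := by
      have : A * ρ ^ γ = A * ρ ^ (-τ) * ρ ^ (γ + τ) := by
        rw [mul_assoc, ← Real.rpow_add hρ]; congr 2; ring
      rw [this]
      have : A * ρ ^ (-τ) ≤ A' := by rw [hA']; linarith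
      gcongr
    have h6 : A' * ρ ^ (γ + τ) ≤ A' * halfBarrier k ξ z := by gcongr
    simp only [hV]
    linarith [hpos z hz]
  · intro z hz hzρ hzℓ
    have h1 := (halfBarrier_bounds hn k hξ hz hzℓ.ge).1
    have h2 : 0 < ‖z‖ ^ k := norm_rpow_pos hz _
    have hRz : R z = z := by
      apply Submodule.reflection_mem_subspace_eq_self
      rw [Submodule.mem_orthogonal_singleton_iff_inner_right]
      rw [hξdef, inner_smul_left] at hzℓ
      simpa [hxy0.ne'] using hzℓ
    have h6 : 0 < A' * halfBarrier k ξ z := mul_pos hA'pos (h2.trans_le h1)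
    simp only [hV, hRz]
    linarith
  · intro z hz hzρ hzℓ _
    obtain ⟨-, h2, h3⟩ := halfBarrier_bounds hn k hξ hz hzℓ.le
    have h4 : 0 < ‖z‖ ^ k := norm_rpow_pos hz _
    have e1 := heq z hz hzρ
    have e2 := heq (R z) (hR0 z hz) (by rwa [R.norm_map])
    rw [R.norm_map] at e2
    rw [abs_le] at e1 e2
    have h5 : ‖z‖ ^ (s * κ) ≤ ‖z‖ ^ k := by
      rw [hk, norm_rpow_mul_eq, norm_rpow_mul_eq]
      exact Real.rpow_le_rpow_of_exponent_ge (norm_rpow_pos hz s) (hzρ.trans hρ1) hτκ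
    rw [hV, cylLapl_sub ((hwR z hz).sub (hw z hz))
      (contDiffAt_const.mul (contDiffAt_halfBarrier k ξ hz)), cylLapl_sub (hwR z hz) (hw z hz),
      cylLapl_const_mul (contDiffAt_halfBarrier k ξ hz), cylLapl_comp_isometry R (hw _ (hR0 z hz))]
    have hk2 : k ^ 2 = γ ^ 2 + (2 * γ * τ + τ ^ 2) := by
      rw [hk, mul_pow, hs2]; ring
    have h6 : C * ‖z‖ ^ (s * κ) ≤ C * ‖z‖ ^ k := by gcongr
    have h7 : k ^ 2 * halfBarrier k ξ z - 2 * ‖z‖ ^ k ≤ γ ^ 2 * halfBarrier k ξ z - ‖z‖ ^ k := by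
      have h8 := (halfBarrier_bounds hn k hξ hz hzℓ.le).1
      have h9 : (2 * γ * τ + τ ^ 2) * halfBarrier k ξ z ≤ 1 / 3 * (3 * ‖z‖ ^ k) :=
        mul_le_mul hτ1 h2 (h4.le.trans h8) (by norm_num)
      rw [hk2]
      linarith
    have h10 : A' * cylLapl (halfBarrier k ξ) z ≤ A' * (γ ^ 2 * halfBarrier k ξ z - ‖z‖ ^ k) := by
      gcongr
      exact h3.trans h7
    have h11 : 2 * C * ‖z‖ ^ k < A' * ‖z‖ ^ k := by
      have : 2 * C < A' := by
        have : 0 < A * ρ ^ (-τ) := by positivity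
        rw [hA']; linarith
      gcongr
    linarith

/-- Existence of the limit of `|x|^(-sγ) w` at an end. -/
lemma exists_limit_norm_rpow_mul (hn : 3 ≤ n) {s : ℝ} (hs : s = 1 ∨ s = -1) {γ κ A C ρ : ℝ}
    (hγ : 0 < γ) (hγκ : γ < κ) (hA : 0 < A) (hC : 0 ≤ C) (hρ : 0 < ρ) (hρ1 : ρ ≤ 1) {w : Eu n → ℝ}
    (hw : ∀ x, x ≠ 0 → ContDiffAt ℝ 2 w x) (hpos : ∀ x, x ≠ 0 → 0 < w x)
    (hwA : ∀ x, x ≠ 0 → ‖x‖ ^ s ≤ ρ → w x ≤ A * ‖x‖ ^ (s * γ))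
    (hsup : ∀ x, x ≠ 0 → cylLapl w x < γ ^ 2 * w x)
    (heq : ∀ x, x ≠ 0 → ‖x‖ ^ s ≤ ρ → |cylLapl w x - γ ^ 2 * w x| ≤ C * ‖x‖ ^ (s * κ)) :
    ∃ L > 0, ∀ ε > 0, ∃ r > 0, ∀ x, x ≠ 0 → ‖x‖ ^ s ≤ r →
      |‖x‖ ^ (-(s * γ)) * w x - L| ≤ ε := by
  obtain ⟨τ, hτ, B, hB, hosc⟩ := exists_sub_le_of_norm_eq hn hs hγ hγκ hA hC hρ hρ1 hw hpos hwA heq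
  have hs0 : s * s = 1 := by rcases hs with rfl | rfl <;> norm_num
  set g : Eu n → ℝ := fun x => ‖x‖ ^ (-(s * γ)) * w x with hg
  have hgw : ∀ x, x ≠ 0 → w x = g x * ‖x‖ ^ (s * γ) := by
    intro x hx
    simp only [hg]
    rw [mul_right_comm, ← Real.rpow_add (norm_pos_iff.2 hx)]
    simp
  have hgpos : ∀ x, x ≠ 0 → 0 < g x := fun x hx => mul_pos (norm_rpow_pos hx _) (hpos x hx)
  have hgA : ∀ x, x ≠ 0 → ‖x‖ ^ s ≤ ρ → g x ≤ A := by
    intro x hx hxρ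
    have := hwA x hx hxρ
    rw [hgw x hx] at this
    exact le_of_mul_le_mul_right this (norm_rpow_pos hx _)
  have hmono : ∀ x y, x ≠ 0 → y ≠ 0 → ‖x‖ ^ s ≤ ρ → ‖y‖ ^ s ≤ ‖x‖ ^ s →
      g x - B * (‖x‖ ^ s) ^ τ ≤ g y := by
    intro x y hx hy hxρ hyx
    rcases le_or_gt (g x - B * (‖x‖ ^ s) ^ τ) 0 with h0 | h0
    · exact h0.trans (hgpos y hy).le
    have := mul_norm_rpow_le_of_sphere (ρ := ‖x‖ ^ s) hs hγ h0.le hw hpos hsup ?_ y hy hyx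
    · rw [hgw y hy] at this
      exact le_of_mul_le_mul_right this (norm_rpow_pos hy _)
    · intro z hz hzx
      have hzx' : ‖z‖ = ‖x‖ := by
        have h1 : (‖z‖ ^ s) ^ s = (‖x‖ ^ s) ^ s := by rw [hzx]
        rwa [← Real.rpow_mul (norm_nonneg _), ← Real.rpow_mul (norm_nonneg _), hs0, Real.rpow_one,
          Real.rpow_one] at h1
      have h2 := hosc z x hz hzx' (by rwa [hzx'])
      rw [hgw x hx, hzx', mul_add, Real.rpow_add (norm_pos_iff.2 hx)] at h2
      rw [hzx', ← norm_rpow_mul_eq]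
      linarith
  set S : Set ℝ := {t | ∃ x : Eu n, x ≠ 0 ∧ ‖x‖ ^ s ≤ ρ ∧ t = g x - B * (‖x‖ ^ s) ^ τ} with hS
  have hSb : BddAbove S := by
    refine ⟨A, ?_⟩
    rintro t ⟨x, hx, hxρ, rfl⟩
    have : 0 < B * (‖x‖ ^ s) ^ τ := by have := norm_rpow_pos hx s; positivity
    linarith [hgA x hx hxρ]
  have : Nonempty (Fin n) := ⟨⟨0, by omega⟩⟩
  have hex : ∀ r : ℝ, 0 < r → ∃ x : Eu n, x ≠ 0 ∧ ‖x‖ ^ s = r := by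
    intro r hr
    have hrs : 0 < r ^ s := by positivity
    refine ⟨EuclideanSpace.single (Classical.arbitrary _) (r ^ s), ?_, ?_⟩
    · rw [← norm_pos_iff, PiLp.norm_single, norm_of_nonneg hrs.le]; exact hrs
    · rw [PiLp.norm_single, norm_of_nonneg hrs.le, ← Real.rpow_mul hr.le, hs0,
        Real.rpow_one]
  have hSn : S.Nonempty := by
    obtain ⟨x, hx, hxr⟩ := hex ρ hρ
    exact ⟨_, x, hx, hxr.le, rfl⟩
  have hle : ∀ x, x ≠ 0 → ‖x‖ ^ s ≤ ρ → g x - B * (‖x‖ ^ s) ^ τ ≤ sSup S := fun x hx hxρ =>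
    le_csSup hSb ⟨x, hx, hxρ, rfl⟩
  have hsmall : ∀ ε > 0, ∃ r > 0, r ≤ ρ ∧ ∀ t, 0 < t → t ≤ r → B * t ^ τ ≤ ε := by
    intro ε hε
    refine ⟨min ρ ((ε / B) ^ (1 / τ)), lt_min hρ (by positivity), min_le_left _ _,
      fun t ht htr => ?_⟩
    have h1 := Real.rpow_le_rpow ht.le (htr.trans (min_le_right _ _)) hτ.le
    rw [← Real.rpow_mul (by positivity), one_div_mul_cancel hτ.ne', Real.rpow_one,
      le_div_iff₀' hB] at h1
    exact h1
  refine ⟨sSup S, ?_, fun ε hε => ?_⟩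
  · obtain ⟨m, hm, hmin⟩ := (isCompact_norm_rpow_mem_Icc (n := n) hs hρ le_rfl).exists_isMinOn
      (f := g) (by obtain ⟨x, hx, hxr⟩ := hex ρ hρ; exact ⟨x, hx, hxr.ge, hxr.le⟩)
      (fun x hx => ((contDiffAt_norm_rpow hx.1 _).mul (hw x hx.1)).continuousAt.continuousWithinAt)
    have hgm := hgpos m hm.1
    obtain ⟨r, hr, hrρ, hBr⟩ := hsmall (g m / 2) (by positivity)
    obtain ⟨x, hx, hxr⟩ := hex r hr
    have h1 := mul_norm_rpow_le_of_sphere (ρ := ρ) (c := g m) hs hγ hgm.le hw hpos hsup ?_ x hx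
      (hxr.trans_le hrρ)
    · rw [hgw x hx] at h1
      have h2 := le_of_mul_le_mul_right h1 (norm_rpow_pos hx _)
      have h3 := hle x hx (hxr.trans_le hrρ)
      have h4 := hBr r hr le_rfl
      rw [hxr] at h3
      linarith
    · intro y hy hyρ
      rw [hgw y hy]
      have h5 : g m ≤ g y := hmin ⟨hy, hyρ.ge, hyρ.le⟩
      have := norm_rpow_pos hy (s * γ)
      gcongr
  · obtain ⟨t, ⟨x, hx, hxρ, rfl⟩, hxt⟩ := exists_lt_of_lt_csSup hSn (sub_lt_self (sSup S) hε)
    obtain ⟨r, hr, hrρ, hBr⟩ := hsmall ε hε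
    refine ⟨min r (‖x‖ ^ s), lt_min hr (norm_rpow_pos hx s), fun y hy hyr => ?_⟩
    have hyr' := hyr.trans (min_le_left _ _)
    have h1 := hmono x y hx hy hxρ (hyr.trans (min_le_right _ _))
    have h2 := hle y hy (hyr'.trans hrρ)
    have h3 := hBr _ (norm_rpow_pos hy s) hyr'
    rw [abs_le]
    change -ε ≤ g y - sSup S ∧ g y - sSup S ≤ ε
    constructor <;> linarith

end Asymptotics

section System

variable {n : ℕ}

/-- The right-hand side of one equation of the system. -/
def coupling (p c α β s t : ℝ) : ℝ := s ^ (p - 1) + c * s ^ (α - 1) * t ^ β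

lemma rpow_le_coupling {p c α β s t : ℝ} (hc : 0 ≤ c) (hs : 0 < s) (ht : 0 < t) :
    s ^ (p - 1) ≤ coupling p c α β s t := by
  unfold coupling
  have : 0 ≤ c * s ^ (α - 1) * t ^ β := by positivity
  linarith

lemma coupling_pos {p c α β s t : ℝ} (hc : 0 ≤ c) (hs : 0 < s) (ht : 0 < t) :
    0 < coupling p c α β s t :=
  lt_of_lt_of_le (by positivity) (rpow_le_coupling hc hs ht)

lemma coupling_le {p c α β s t : ℝ} (hc : 0 ≤ c) (hα : 1 < α) (hβ : 1 < β) (hp : α + β = p)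
    (hs : 0 < s) (ht : 0 < t) : coupling p c α β s t ≤ (1 + c) * (s + t) ^ (p - 1) := by
  unfold coupling
  have h1 : s ^ (p - 1) ≤ (s + t) ^ (p - 1) :=
    Real.rpow_le_rpow hs.le (by linarith) (by linarith)
  have h2 : s ^ (α - 1) ≤ (s + t) ^ (α - 1) :=
    Real.rpow_le_rpow hs.le (by linarith) (by linarith)
  have h3 : t ^ β ≤ (s + t) ^ β := Real.rpow_le_rpow ht.le (by linarith) (by linarith)
  have h4 : (s + t) ^ (p - 1) = (s + t) ^ (α - 1) * (s + t) ^ β := by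
    rw [← Real.rpow_add (by positivity)]; congr 1; linarith
  have h5 : s ^ (α - 1) * t ^ β ≤ (s + t) ^ (p - 1) := by
    rw [h4]; gcongr
  have h6 : c * (s ^ (α - 1) * t ^ β) ≤ c * (s + t) ^ (p - 1) := by gcongr
  linarith

lemma coupling_mul {p c α β r s t : ℝ} (hp : α + β = p) (hr : 0 < r) (hs : 0 < s) (ht : 0 < t) :
    coupling p c α β (r * s) (r * t) = r ^ (p - 1) * coupling p c α β s t := by
  unfold coupling
  have h4 : r ^ (p - 1) = r ^ (α - 1) * r ^ β := by
    rw [← Real.rpow_add (by positivity)]; congr 1; linarith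
  rw [Real.mul_rpow hr.le hs.le, Real.mul_rpow hr.le hs.le, Real.mul_rpow hr.le ht.le, mul_add,
    h4]
  ring

lemma lapl_sub_eq_of_wdiv_eq {a b p F : ℝ} {u : Eu n → ℝ} {x : Eu n} (hx : x ≠ 0)
    (h : -(wdiv a u x) = ‖x‖ ^ (-(b * p)) * F) :
    lapl u x - 2 * a * fderiv ℝ u x x / ‖x‖ ^ 2 = -(‖x‖ ^ (2 * a - b * p) * F) := by
  have hpos : 0 < ‖x‖ := norm_pos_iff.2 hx
  have hg : (inner ℝ x (gradient u x) : ℝ) = fderiv ℝ u x x := by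
    rw [inner_gradient_right]; simp
  unfold wdiv at h
  rw [hg] at h
  have h1 : ‖x‖ ^ (2 * a) * ‖x‖ ^ (-(2 * a)) = 1 := by
    rw [← Real.rpow_add hpos]; simp
  have h2 : ‖x‖ ^ (2 * a - b * p) = ‖x‖ ^ (2 * a) * ‖x‖ ^ (-(b * p)) := by
    rw [← Real.rpow_add hpos]; rfl
  rw [h2, mul_assoc (‖x‖ ^ (2 * a)), ← h]
  linear_combination (-(lapl u x - 2 * a * fderiv ℝ u x x / ‖x‖ ^ 2)) * h1

lemma cylLapl_rescaled {a b p c α β γ : ℝ} (hγ : n - 2 - 2 * a = 2 * γ) (hpn : p * (b + γ) = n)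
    (hp : α + β = p) {u v : Eu n → ℝ} {x : Eu n} (hx : x ≠ 0) (hu : ContDiffAt ℝ 2 u x)
    (hu0 : 0 < u x) (hv0 : 0 < v x)
    (h : lapl u x - 2 * a * fderiv ℝ u x x / ‖x‖ ^ 2
      = -(‖x‖ ^ (2 * a - b * p) * coupling p c α β (u x) (v x))) :
    cylLapl (fun y => ‖y‖ ^ γ * u y) x = γ ^ 2 * (‖x‖ ^ γ * u x)
      - coupling p c α β (‖x‖ ^ γ * u x) (‖x‖ ^ γ * v x) := by
  have hpos : 0 < ‖x‖ := norm_pos_iff.2 hx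
  rw [cylLapl_norm_rpow_mul hx γ hu, coupling_mul hp (by positivity) hu0 hv0,
    ← Real.rpow_mul hpos.le]
  have h1 : ‖x‖ ^ (γ * (p - 1)) = ‖x‖ ^ γ * ‖x‖ ^ 2 * ‖x‖ ^ (2 * a - b * p) := by
    rw [← Real.rpow_natCast, ← Real.rpow_add hpos, ← Real.rpow_add hpos]
    congr 1
    push_cast
    linarith
  have h2 : ‖x‖ ^ 2 * lapl u x = 2 * a * fderiv ℝ u x x
      - ‖x‖ ^ 2 * (‖x‖ ^ (2 * a - b * p) * coupling p c α β (u x) (v x)) := by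
    rw [eq_comm, neg_eq_iff_eq_neg] at h
    rw [h]
    field_simp
    ring
  rw [h1, h2]
  linear_combination (‖x‖ ^ γ * fderiv ℝ u x x) * (-hγ)

/-- Asymptotics of a solution of the cylindrical system that vanishes at an end. -/
lemma exists_limit_of_system (hn : 3 ≤ n) {s : ℝ} (hs : s = 1 ∨ s = -1) {γ p α β c d : ℝ}
    (hγ : 0 < γ) (hc : 0 ≤ c) (hd : 0 ≤ d) (hα : 1 < α) (hβ : 1 < β) (hp : α + β = p)
    {w z : Eu n → ℝ} (hw : ∀ x, x ≠ 0 → ContDiffAt ℝ 2 w x) (hz : ∀ x, x ≠ 0 → ContDiffAt ℝ 2 z x)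
    (hw0 : ∀ x, x ≠ 0 → 0 < w x) (hz0 : ∀ x, x ≠ 0 → 0 < z x)
    (hweq : ∀ x, x ≠ 0 → cylLapl w x = γ ^ 2 * w x - coupling p c α β (w x) (z x))
    (hzeq : ∀ x, x ≠ 0 → cylLapl z x = γ ^ 2 * z x - coupling p d β α (z x) (w x))
    (hlim : ∀ η > 0, ∃ ρ > 0, ∀ x, x ≠ 0 → ‖x‖ ^ s ≤ ρ → w x + z x ≤ η) :
    ∃ L > 0, ∀ ε > 0, ∃ r > 0, ∀ x, x ≠ 0 → ‖x‖ ^ s ≤ r →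
      |‖x‖ ^ (-(s * γ)) * w x - L| ≤ ε := by
  have hp2 : 2 < p := by linarith
  have hp' : β + α = p := by linarith
  have hc1 : ∀ x, x ≠ 0 → coupling p c α β (w x) (z x) ≤ (1 + c) * (w x + z x) ^ (p - 1) :=
    fun x hx => coupling_le hc hα hβ hp (hw0 x hx) (hz0 x hx)
  have hc2 : ∀ x, x ≠ 0 → coupling p d β α (z x) (w x) ≤ (1 + d) * (w x + z x) ^ (p - 1) :=
    fun x hx => by
      rw [add_comm (w x)]; exact coupling_le hd hβ hα hp' (hz0 x hx) (hw0 x hx)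
  obtain ⟨A, hA, ρ, hρ, hY⟩ := exists_le_mul_norm_rpow (C := 2 + c + d) (Y := fun x => w x + z x)
    hs hγ hp2 (by positivity) (fun x hx => (hw x hx).add (hz x hx))
    (fun x hx => add_pos (hw0 x hx) (hz0 x hx))
    (fun x hx => by
      rw [cylLapl_add (hw x hx) (hz x hx), hweq x hx, hzeq x hx]
      have := hc1 x hx
      have := hc2 x hx
      linarith) hlim
  refine exists_limit_norm_rpow_mul (κ := γ * (p - 1)) (A := A) (C := (1 + c) * A ^ (p - 1))
    (ρ := min ρ 1) hn hs hγ (by nlinarith) hA (by positivity) (lt_min hρ one_pos) (min_le_right _ _)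
    hw hw0 (fun x hx hxρ => ?_) (fun x hx => ?_) (fun x hx hxρ => ?_)
  · linarith [hY x hx (hxρ.trans (min_le_left _ _)), hz0 x hx]
  · rw [hweq x hx]
    linarith [coupling_pos (p := p) (α := α) (β := β) hc (hw0 x hx) (hz0 x hx)]
  · rw [hweq x hx, sub_sub_cancel_left, abs_neg, abs_of_pos (coupling_pos hc (hw0 x hx) (hz0 x hx))]
    refine (hc1 x hx).trans ?_
    have h1 := Real.rpow_le_rpow (add_pos (hw0 x hx) (hz0 x hx)).le
      (hY x hx (hxρ.trans (min_le_left _ _))) (show 0 ≤ p - 1 by linarith)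
    rw [Real.mul_rpow hA.le (norm_rpow_pos hx _).le, ← Real.rpow_mul (norm_nonneg _),
      mul_assoc s] at h1
    rw [mul_assoc]
    gcongr

lemma tendsto_nhdsNE_zero_of_abs_sub_le {f : Eu n → ℝ} {L : ℝ}
    (h : ∀ ε > 0, ∃ r > 0, ∀ x, x ≠ 0 → ‖x‖ ^ (1 : ℝ) ≤ r → |f x - L| ≤ ε) :
    Tendsto f (𝓝[≠] 0) (𝓝 L) := by
  rw [Metric.tendsto_nhdsWithin_nhds]
  intro ε hε
  obtain ⟨r, hr, hf⟩ := h (ε / 2) (by positivity)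
  refine ⟨r, hr, fun x hx hxr => ?_⟩
  rw [dist_zero_right] at hxr
  rw [Real.dist_eq]
  exact (hf x hx (by rw [Real.rpow_one]; exact hxr.le)).trans_lt (by linarith)

lemma tendsto_comap_norm_atTop_of_abs_sub_le {f : Eu n → ℝ} {L : ℝ}
    (h : ∀ ε > 0, ∃ r > 0, ∀ x, x ≠ 0 → ‖x‖ ^ (-1 : ℝ) ≤ r → |f x - L| ≤ ε) :
    Tendsto f (comap (fun x : Eu n => ‖x‖) atTop) (𝓝 L) := by
  rw [Metric.tendsto_nhds]
  intro ε hε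
  obtain ⟨r, hr, hf⟩ := h (ε / 2) (by positivity)
  have : ∀ᶠ x : Eu n in comap (fun x : Eu n => ‖x‖) atTop, r⁻¹ ≤ ‖x‖ :=
    tendsto_comap.eventually (eventually_ge_atTop _)
  filter_upwards [this] with x hx
  have hpos : 0 < ‖x‖ := lt_of_lt_of_le (by positivity) hx
  rw [Real.dist_eq]
  refine (hf x (norm_pos_iff.1 hpos) ?_).trans_lt (by linarith)
  rw [Real.rpow_neg_one]
  exact inv_le_of_inv_le₀ hr hx

end System

section MeanValue

variable {n : ℕ}

lemma continuous_fderiv_apply_of_contDiff {G : Eu n → ℝ} (hG : ContDiff ℝ 1 G) (v : Eu n) :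
    Continuous fun x => fderiv ℝ G x v :=
  (hG.continuous_fderiv (by simp)).clm_apply continuous_const

lemma contDiff_fderiv_apply {G : Eu n → ℝ} (hG : ContDiff ℝ 2 G) (v : Eu n) :
    ContDiff ℝ 1 fun x => fderiv ℝ G x v :=
  (hG.fderiv_right (m := 1) (by norm_num)).clm_apply contDiff_const

lemma continuous_lapl {G : Eu n → ℝ} (hG : ContDiff ℝ 2 G) : Continuous (lapl G) := by
  unfold lapl
  exact continuous_finsetSum _ fun i _ =>
    continuous_fderiv_apply_of_contDiff (contDiff_fderiv_apply hG _) _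

/-- Green's identity against a compactly supported test function. -/
lemma integral_mul_lapl {φ G : Eu n → ℝ} (hφ : ContDiff ℝ 1 φ) (hφc : HasCompactSupport φ)
    (hG : ContDiff ℝ 2 G) :
    ∫ x, φ x * lapl G x = -∫ x, ∑ i, fderiv ℝ φ x (EuclideanSpace.single i 1)
      * fderiv ℝ G x (EuclideanSpace.single i 1) := by
  have hc : ∀ {f g : Eu n → ℝ}, Continuous f → HasCompactSupport f → Continuous g →
      Integrable fun x => f x * g x := fun hf hfc hg =>
    (hf.mul hg).integrable_of_hasCompactSupport hfc.mul_right
  have hG1 := fun v => contDiff_fderiv_apply hG v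
  have hφ' := fun v : Eu n => hφc.fderiv_apply (𝕜 := ℝ) v
  have h1 := fun i : Fin n => hc (continuous_fderiv_apply_of_contDiff hφ
    (EuclideanSpace.single i 1)) (hφ' _) (hG1 (EuclideanSpace.single i 1)).continuous
  have h2 := fun i : Fin n => hc hφ.continuous hφc
    (continuous_fderiv_apply_of_contDiff (hG1 (EuclideanSpace.single i 1))
      (EuclideanSpace.single i 1))
  simp only [lapl, Finset.mul_sum]
  rw [integral_finsetSum _ fun i _ => h2 i, integral_finsetSum _ fun i _ => h1 i,
    ← Finset.sum_neg_distrib]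
  refine Finset.sum_congr rfl fun i _ => ?_
  exact integral_mul_fderiv_eq_neg_fderiv_mul_of_integrable (h1 i) (h2 i)
    (hc hφ.continuous hφc (hG1 _).continuous) (fun x _ => hφ.differentiable (by simp) x)
    (fun x _ => (hG1 _).differentiable (by simp) x)

lemma exists_bump (hn : 1 ≤ n) : ∃ φ ψ : Eu n → ℝ, ContDiff ℝ 1 φ ∧ ContDiff ℝ 1 ψ ∧
    (∀ y, 0 ≤ φ y) ∧ (∀ y, 0 ≤ ψ y) ∧ (∀ y, 1 ≤ ‖y‖ → φ y = 0) ∧ (∀ y, 1 ≤ ‖y‖ → ψ y = 0) ∧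
    (∀ y v, fderiv ℝ ψ y v = -(φ y * inner ℝ y v)) ∧ 0 < ∫ y, φ y := by
  have hE : ContDiff ℝ 2 expNegInvGlue := expNegInvGlue.contDiff (n := 2)
  have hE1 : ContDiff ℝ 1 (deriv expNegInvGlue) := by
    have : ContDiff ℝ (1 + 1) expNegInvGlue := by norm_num; exact hE
    exact (contDiff_succ_iff_deriv.1 this).2.2
  have hns : ContDiff ℝ 1 fun y : Eu n => 1 - ‖y‖ ^ 2 := contDiff_const.sub (contDiff_norm_sq ℝ)
  have hnon : ∀ t, 0 ≤ deriv expNegInvGlue t := fun t => expNegInvGlue.monotone.deriv_nonneg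
  have hzero : ∀ t, t ≤ 0 → deriv expNegInvGlue t = 0 := fun t ht => by
    have : IsLocalMin expNegInvGlue t := Eventually.of_forall fun s => by
      rw [expNegInvGlue.zero_of_nonpos ht]; exact expNegInvGlue.nonneg s
    exact this.deriv_eq_zero
  have hle : ∀ y : Eu n, 1 ≤ ‖y‖ → 1 - ‖y‖ ^ 2 ≤ 0 := fun y hy => by nlinarith
  have hφ : ContDiff ℝ 1 fun y : Eu n => 2 * deriv expNegInvGlue (1 - ‖y‖ ^ 2) :=
    contDiff_const.mul (hE1.comp hns)
  have hφ0 : ∀ y : Eu n, 1 ≤ ‖y‖ → 2 * deriv expNegInvGlue (1 - ‖y‖ ^ 2) = 0 := fun y hy => by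
    rw [hzero _ (hle y hy), mul_zero]
  refine ⟨fun y => 2 * deriv expNegInvGlue (1 - ‖y‖ ^ 2), fun y => expNegInvGlue (1 - ‖y‖ ^ 2),
    hφ, (hE.of_le (by norm_num)).comp hns,
    fun y => mul_nonneg zero_le_two (hnon _), fun y => expNegInvGlue.nonneg _,
    hφ0, fun y hy => expNegInvGlue.zero_of_nonpos (hle y hy), fun y v => ?_, ?_⟩
  · have h1 : HasFDerivAt (fun y : Eu n => 1 - ‖y‖ ^ 2) (-(2 • innerSL ℝ y)) y :=
      ((hasStrictFDerivAt_norm_sq y).hasFDerivAt).const_sub 1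
    have h2 := ((hE.differentiable (by simp)) (1 - ‖y‖ ^ 2)).hasDerivAt.comp_hasFDerivAt y h1
    have h3 := h2.fderiv
    simp only [Function.comp_def] at h3
    rw [h3]
    simp
    ring
  · obtain ⟨t, ht, hdt⟩ := exists_deriv_eq_slope expNegInvGlue (zero_lt_one' ℝ)
      hE.continuous.continuousOn (hE.differentiable (by simp)).differentiableOn
    have ht' : 0 < deriv expNegInvGlue t := by
      rw [hdt, expNegInvGlue.zero]
      have := expNegInvGlue.pos_of_pos one_pos
      simpa using this
    have hN : Nonempty (Fin n) := ⟨⟨0, by omega⟩⟩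
    refine Continuous.integral_pos_of_hasCompactSupport_nonneg_nonzero hφ.continuous
      (HasCompactSupport.intro (isCompact_closedBall 0 1) fun y hy => hφ0 y ?_)
      (fun y => mul_nonneg zero_le_two (hnon _))
      (x := EuclideanSpace.single (Classical.arbitrary _) (√(1 - t))) ?_
    · simp at hy; exact hy.le
    · rw [PiLp.norm_single, norm_of_nonneg (Real.sqrt_nonneg _),
        Real.sq_sqrt (by linarith [ht.2])]
      simp [ht'.ne']

/-- A mean value inequality for functions whose Laplacian is bounded below. -/
lemma mul_integral_le_of_le_lapl {φ ψ : Eu n → ℝ} (hφ : ContDiff ℝ 1 φ) (hψ : ContDiff ℝ 1 ψ)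
    (hψ0 : ∀ y, 0 ≤ ψ y) (hφ1 : ∀ y, 1 ≤ ‖y‖ → φ y = 0)
    (hψ1 : ∀ y, 1 ≤ ‖y‖ → ψ y = 0) (hψφ : ∀ y v, fderiv ℝ ψ y v = -(φ y * inner ℝ y v))
    {G : Eu n → ℝ} (hG : ContDiff ℝ 2 G) (hGc : HasCompactSupport G) {z : Eu n} {σ K : ℝ}
    (hσ : 0 < σ) (hK : ∀ x, ‖x - z‖ ≤ σ → -K ≤ lapl G x) :
    G z * ∫ y, φ y ≤ (∫ y, G (z + σ • y) * φ y) + K * σ ^ 2 / 2 * ∫ y, ψ y := by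
  have hG1 : ContDiff ℝ 1 G := hG.of_le (by norm_num)
  have hsupp : ∀ {f : Eu n → ℝ}, (∀ y, 1 ≤ ‖y‖ → f y = 0) → HasCompactSupport f := fun hf =>
    HasCompactSupport.intro (isCompact_closedBall 0 1) fun y hy => hf y (by
      simp at hy; exact hy.le)
  have hφc := hsupp hφ1
  have hψc := hsupp hψ1
  have hfc : Continuous (fderiv ℝ G) := hG1.continuous_fderiv (by simp)
  obtain ⟨M, hM⟩ := hfc.bounded_above_of_compact_support (hGc.fderiv (𝕜 := ℝ))
  have haff : ∀ r : ℝ, Continuous fun y : Eu n => z + r • y := fun r => by fun_prop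
  set A : ℝ → ℝ := fun r => ∫ y, G (z + r • y) * φ y with hA
  set A' : ℝ → ℝ := fun r => ∫ y, fderiv ℝ G (z + r • y) y * φ y with hA'
  have hder : ∀ r, HasDerivAt A (A' r) r := by
    intro r
    refine (hasDerivAt_integral_of_dominated_loc_of_deriv_le (s := Set.univ)
      (F := fun r y => G (z + r • y) * φ y)
      (F' := fun r y => fderiv ℝ G (z + r • y) y * φ y) (bound := fun y => M * ‖y‖ * ‖φ y‖)
      univ_mem ?_ ?_ ?_ ?_ ?_ ?_).2
    · exact Eventually.of_forall fun t =>
        ((hG.continuous.comp (haff t)).mul hφ.continuous).aestronglyMeasurable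
    · exact ((hG.continuous.comp (haff r)).mul hφ.continuous).integrable_of_hasCompactSupport
        hφc.mul_left
    · exact (((hfc.comp (haff r)).clm_apply continuous_id).mul hφ.continuous).aestronglyMeasurable
    · refine Eventually.of_forall fun y t _ => ?_
      rw [norm_mul]
      gcongr
      exact ((fderiv ℝ G _).le_opNorm y).trans (by gcongr; exact hM _)
    · exact ((continuous_const.mul continuous_norm).mul
        hφ.continuous.norm).integrable_of_hasCompactSupport hφc.norm.mul_left
    · refine Eventually.of_forall fun y t _ => ?_
      have h1 : HasDerivAt (fun t : ℝ => z + t • y) y t := by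
        have := ((hasDerivAt_id t).smul_const y).const_add z
        rw [one_smul] at this
        exact this
      exact (((hG1.differentiable (by simp)) (z + t • y)).hasFDerivAt.comp_hasDerivAt t
        h1).mul_const _
  have hA'eq : ∀ r, 0 < r → A' r = r * ∫ y, ψ y * lapl G (z + r • y) := by
    intro r hr
    have hGr : ContDiff ℝ 2 fun y : Eu n => G (z + r • y) :=
      hG.comp (contDiff_const.add (contDiff_const_smul r))
    have h := integral_mul_lapl hψ hψc hGr
    have e1 : ∀ y, ψ y * lapl (fun y => G (z + r • y)) y = r ^ 2 * (ψ y * lapl G (z + r • y)) :=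
      fun y => by rw [lapl_comp_affine]; ring
    have e2 : ∀ y : Eu n, ∑ i, fderiv ℝ ψ y (EuclideanSpace.single i 1)
        * fderiv ℝ (fun y => G (z + r • y)) y (EuclideanSpace.single i 1)
        = (-r) * (fderiv ℝ G (z + r • y) y * φ y) := fun y => by
      rw [← sum_apply_single (fderiv ℝ G (z + r • y)) y, Finset.sum_mul, Finset.mul_sum]
      refine Finset.sum_congr rfl fun i _ => ?_
      rw [hψφ, fderiv_comp_affine]
      simp [EuclideanSpace.inner_single_right]
      ring
    simp only [e1, e2] at h
    rw [integral_const_mul, integral_const_mul] at h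
    have : r * (r * ∫ y, ψ y * lapl G (z + r • y)) = r * A' r := by
      simp only [hA']; linarith
    exact (mul_left_cancel₀ hr.ne' this).symm
  have hψi : Integrable ψ := hψ.continuous.integrable_of_hasCompactSupport hψc
  have hlow : ∀ r, 0 < r → r ≤ σ → -(K * r * ∫ y, ψ y) ≤ A' r := by
    intro r hr hrσ
    have h1 : ∫ y, -K * ψ y ≤ ∫ y, ψ y * lapl G (z + r • y) := by
      refine integral_mono (hψi.const_mul _) ((hψ.continuous.mul ((continuous_lapl hG).comp
        (haff r))).integrable_of_hasCompactSupport hψc.mul_right) fun y => ?_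
      rcases le_or_gt 1 ‖y‖ with hy | hy
      · simp [hψ1 y hy]
      · have h2 := hK (z + r • y) (by
          rw [add_sub_cancel_left, norm_smul, norm_of_nonneg hr.le]; nlinarith)
        have h3 := mul_le_mul_of_nonneg_left h2 (hψ0 y)
        change -K * ψ y ≤ ψ y * lapl G (z + r • y)
        linarith
    rw [integral_const_mul] at h1
    rw [hA'eq r hr]
    have := mul_le_mul_of_nonneg_left h1 hr.le
    linarith
  set D : ℝ → ℝ := fun r => A r + K * r ^ 2 / 2 * ∫ y, ψ y with hD
  have hDd : ∀ r, HasDerivAt D (A' r + K * r * ∫ y, ψ y) r := by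
    intro r
    have h1 : HasDerivAt (fun r : ℝ => K * r ^ 2 / 2 * ∫ y, ψ y) (K * r * ∫ y, ψ y) r := by
      have := (((hasDerivAt_pow 2 r).const_mul K).div_const 2).mul_const (∫ y, ψ y)
      exact this.congr_deriv (by push_cast; ring)
    exact (hder r).add h1
  have hmono : MonotoneOn D (Set.Icc 0 σ) := by
    refine monotoneOn_of_deriv_nonneg (convex_Icc 0 σ)
      (fun r _ => (hDd r).continuousAt.continuousWithinAt)
      (fun r _ => (hDd r).differentiableAt.differentiableWithinAt) fun r hr => ?_
    rw [interior_Icc] at hr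
    rw [(hDd r).deriv]
    linarith [hlow r hr.1 hr.2.le]
  have h := hmono ⟨le_rfl, hσ.le⟩ ⟨hσ.le, le_rfl⟩ hσ.le
  simp only [hD, hA, zero_smul, add_zero] at h
  rw [integral_const_mul] at h
  simpa using h

lemma exists_contDiff_eq_near {f : Eu n → ℝ} (hf : ∀ x, x ≠ 0 → ContDiffAt ℝ 2 f x) {z : Eu n}
    {σ : ℝ} (hσ : 0 < σ) (hσz : 3 * σ < ‖z‖) :
    ∃ g : Eu n → ℝ, ContDiff ℝ 2 g ∧ HasCompactSupport g ∧
      ∀ x, ‖x - z‖ ≤ σ → g =ᶠ[𝓝 x] f := by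
  let χ : ContDiffBump z := ⟨2 * σ, 3 * σ, by linarith, by linarith⟩
  refine ⟨fun x => χ x * f x, contDiff_iff_contDiffAt.2 fun x => ?_,
    χ.hasCompactSupport.mul_right, fun x hx => ?_⟩
  · rcases eq_or_ne x 0 with rfl | hx
    · have h0 : (0 : Eu n) ∉ tsupport χ := by
        rw [χ.tsupport_eq, Metric.mem_closedBall, dist_zero_left]
        exact not_le.2 hσz
      have : (fun x => χ x * f x) =ᶠ[𝓝 0] fun _ => 0 := by
        filter_upwards [notMem_tsupport_iff_eventuallyEq.1 h0] with y hy
        rw [hy]; simp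
      exact contDiffAt_const.congr_of_eventuallyEq this
    · exact χ.contDiffAt.mul (hf x hx)
  · have : Metric.ball z (2 * σ) ∈ 𝓝 x := Metric.isOpen_ball.mem_nhds (by
      rw [Metric.mem_ball, dist_eq_norm]; linarith)
    filter_upwards [this] with y hy
    rw [χ.one_of_mem_closedBall (Metric.ball_subset_closedBall hy), one_mul]

end MeanValue

section LocalEstimates

variable {n : ℕ}

lemma integrable_comp_affine_mul {f φ : Eu n → ℝ} (hf : ∀ x, x ≠ 0 → ContinuousAt f x)
    (hφ : Continuous φ) (hφ1 : ∀ y, 1 ≤ ‖y‖ → φ y = 0) {z : Eu n} {σ : ℝ} (hσ : 0 < σ)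
    (hσz : 3 * σ < ‖z‖) : Integrable fun y => f (z + σ • y) * φ y := by
  have hφc : HasCompactSupport φ :=
    HasCompactSupport.intro (isCompact_closedBall 0 1) fun y hy => hφ1 y (by
      simp at hy; exact hy.le)
  refine Continuous.integrable_of_hasCompactSupport (continuous_iff_continuousAt.2 fun y => ?_)
    hφc.mul_left
  have haff : ContinuousAt (fun y : Eu n => z + σ • y) y := by fun_prop
  rcases eq_or_ne (z + σ • y) 0 with h0 | h0
  · have h1 : 1 < ‖y‖ := by
      have h2 : ‖z‖ = σ * ‖y‖ := by
        rw [eq_neg_of_add_eq_zero_left h0, norm_neg, norm_smul, norm_of_nonneg hσ.le]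
      by_contra! h3
      nlinarith
    have h2 : (fun y => f (z + σ • y) * φ y) =ᶠ[𝓝 y] fun _ => 0 := by
      filter_upwards [continuous_norm.continuousAt.eventually_const_lt h1] with w hw
      rw [hφ1 w (le_of_lt hw), mul_zero]
    exact continuousAt_const.congr h2.symm
  · exact (ContinuousAt.comp (f := fun y : Eu n => z + σ • y) (hf _ h0) haff).mul hφ.continuousAt

lemma norm_affine_bounds {z y : Eu n} {σ : ℝ} (hσ : 0 < σ) (hy : ‖y‖ ≤ 1) :
    ‖z‖ - σ ≤ ‖z + σ • y‖ ∧ ‖z + σ • y‖ ≤ ‖z‖ + σ := by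
  have h1 : ‖σ • y‖ ≤ σ := by
    rw [norm_smul, norm_of_nonneg hσ.le]; nlinarith
  constructor
  · have := norm_sub_norm_le z (-(σ • y))
    rw [norm_neg, sub_neg_eq_add] at this
    linarith
  · exact (norm_add_le _ _).trans (by linarith)

/-- Testing the equation with a bump function, the gradient being controlled by its square. -/
lemma integral_rhs_mul_le {φ : Eu n → ℝ} (hφ : ContDiff ℝ 1 φ) (hφ0 : ∀ y, 0 ≤ φ y)
    (hφ1 : ∀ y, 1 ≤ ‖y‖ → φ y = 0) {M a : ℝ} (hM : ∀ y, φ y ≤ M) (hM' : ∀ y, ‖fderiv ℝ φ y‖ ≤ M)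
    (ha : 0 ≤ a) {u g : Eu n → ℝ} (hu : ∀ x, x ≠ 0 → ContDiffAt ℝ 2 u x)
    (heq : ∀ x, x ≠ 0 → lapl u x - 2 * a * fderiv ℝ u x x / ‖x‖ ^ 2 = -g x)
    {z : Eu n} {σ κ : ℝ} (hσ : 0 < σ) (hσz : 3 * σ < ‖z‖) (hκ : 0 < κ) :
    σ * ∫ y, g (z + σ • y) * φ y ≤ (n + 2 * a) * M *
      (κ * volume.real (Metric.closedBall (0 : Eu n) 1)
        + (σ ^ n)⁻¹ * κ⁻¹ * ∫ x in Metric.closedBall z σ, ‖fderiv ℝ u x‖ ^ 2) := by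
  have hM0 : 0 ≤ M := (hφ0 0).trans (hM 0)
  have hφc : HasCompactSupport φ :=
    HasCompactSupport.intro (isCompact_closedBall 0 1) fun y hy => hφ1 y (by
      simp at hy; exact hy.le)
  have hdφ1 : ∀ y, 1 ≤ ‖y‖ → fderiv ℝ φ y = 0 := fun y hy => by
    have : IsLocalMin φ y := Eventually.of_forall fun w => by rw [hφ1 y hy]; exact hφ0 w
    exact this.fderiv_eq_zero
  obtain ⟨G, hG, hGc, hGu⟩ := exists_contDiff_eq_near hu hσ hσz
  set Gσ : Eu n → ℝ := fun y => G (z + σ • y) with hGσ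
  have hGσd : ContDiff ℝ 2 Gσ := hG.comp (contDiff_const.add (contDiff_const_smul σ))
  have hnear : ∀ y : Eu n, ‖y‖ ≤ 1 → G =ᶠ[𝓝 (z + σ • y)] u := fun y hy => hGu _ (by
    rw [add_sub_cancel_left, norm_smul, norm_of_nonneg hσ.le]; nlinarith)
  set q : Eu n → ℝ := fun x => fderiv ℝ u x x / ‖x‖ ^ 2 with hq
  have hqc : ∀ x, x ≠ 0 → ContinuousAt q x := fun x hx => by
    have h1 : ContinuousAt (fderiv ℝ u) x := (hu x hx).differentiableAt_fderiv.continuousAt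
    exact (h1.clm_apply continuousAt_id).div (continuous_norm.pow 2).continuousAt
      (pow_ne_zero 2 (norm_ne_zero_iff.2 hx))
  have hqi := integrable_comp_affine_mul hqc hφ.continuous hφ1 hσ hσz
  have hxn : ∀ y : Eu n, ‖y‖ ≤ 1 → σ ≤ ‖z + σ • y‖ := fun y hy => by
    linarith [(norm_affine_bounds (z := z) hσ hy).1]
  have e1 : ∀ y, σ ^ 2 * (g (z + σ • y) * φ y)
      = -(φ y * lapl Gσ y) + 2 * a * σ ^ 2 * (q (z + σ • y) * φ y) := by
    intro y
    rcases le_or_gt 1 ‖y‖ with hy | hy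
    · simp [hφ1 y hy]
    · have hx0 : z + σ • y ≠ 0 := norm_pos_iff.1 (hσ.trans_le (hxn y hy.le))
      rw [hGσ, lapl_comp_affine, lapl_congr (hnear y hy.le)]
      have h := heq _ hx0
      simp only [hq]
      linear_combination (σ ^ 2 * φ y) * h
  have hint1 : Integrable fun y => φ y * lapl Gσ y :=
    (hφ.continuous.mul (continuous_lapl hGσd)).integrable_of_hasCompactSupport hφc.mul_right
  set T : Eu n → ℝ := fun y => ∑ i, fderiv ℝ φ y (EuclideanSpace.single i 1)
      * fderiv ℝ Gσ y (EuclideanSpace.single i 1) with hT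
  have hint2 : Integrable T := by
    refine integrable_finsetSum _ fun i _ => ?_
    exact ((continuous_fderiv_apply_of_contDiff hφ _).mul
      (contDiff_fderiv_apply hGσd _).continuous).integrable_of_hasCompactSupport
      (hφc.fderiv_apply (𝕜 := ℝ) _).mul_right
  have e2 : σ ^ 2 * ∫ y, g (z + σ • y) * φ y
      = ∫ y, (T y + 2 * a * σ ^ 2 * (q (z + σ • y) * φ y)) := by
    rw [← integral_const_mul, integral_congr_ae (Eventually.of_forall e1),
      integral_add (f := fun y => -(φ y * lapl Gσ y)) hint1.neg (hqi.const_mul _), integral_add hint2 (hqi.const_mul _),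
      integral_neg, integral_mul_lapl hφ hφc hGσd, neg_neg]
  set h : Eu n → ℝ := (Metric.closedBall z σ).indicator fun x => ‖fderiv ℝ u x‖ ^ 2 with hh
  have hball0 : ∀ x ∈ Metric.closedBall z σ, x ≠ 0 := by
    rintro x hx rfl
    rw [Metric.mem_closedBall, dist_zero_left] at hx
    linarith
  have hhi : Integrable h := by
    rw [hh, integrable_indicator_iff Metric.isClosed_closedBall.measurableSet]
    refine ContinuousOn.integrableOn_compact (isCompact_closedBall z σ) fun x hx => ?_
    exact ((hu x (hball0 x hx)).differentiableAt_fderiv.continuousAt.norm.pow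
      2).continuousWithinAt
  have hhσ : Integrable fun y : Eu n => h (z + σ • y) :=
    (hhi.comp_add_left z).comp_smul hσ.ne'
  have hhint : ∫ y : Eu n, h (z + σ • y) = (σ ^ n)⁻¹ * ∫ x in Metric.closedBall z σ,
      ‖fderiv ℝ u x‖ ^ 2 := by
    rw [Measure.integral_comp_smul volume (fun y => h (z + y)) σ, integral_add_left_eq_self h z,
      hh, integral_indicator Metric.isClosed_closedBall.measurableSet, finrank_euclideanSpace_fin,
      abs_of_pos (by positivity), smul_eq_mul]
  set B : Eu n → ℝ := (Metric.closedBall (0 : Eu n) 1).indicator fun _ => 1 with hB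
  have hBi : Integrable B := by
    rw [hB, integrable_indicator_iff Metric.isClosed_closedBall.measurableSet]
    exact integrableOn_const (measure_closedBall_lt_top.ne)
  have hBint : ∫ y, B y = volume.real (Metric.closedBall (0 : Eu n) 1) := by
    rw [hB, integral_indicator Metric.isClosed_closedBall.measurableSet]
    simp
  have e3 : ∀ y, T y + 2 * a * σ ^ 2 * (q (z + σ • y) * φ y)
      ≤ (n + 2 * a) * M * σ * (κ * B y + κ⁻¹ * h (z + σ • y)) := by
    intro y
    have hh0 : 0 ≤ h (z + σ • y) := Set.indicator_nonneg (fun x _ => by positivity) _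
    have hB0 : 0 ≤ B y := Set.indicator_nonneg (fun x _ => by positivity) _
    rcases le_or_gt 1 ‖y‖ with hy | hy
    · have : T y = 0 := by simp [hT, hdφ1 y hy]
      rw [this, hφ1 y hy, mul_zero, mul_zero, zero_add]
      positivity
    · have hx := hxn y hy.le
      have hxpos : 0 < ‖z + σ • y‖ := hσ.trans_le hx
      set x := z + σ • y with hxdef
      set N := ‖fderiv ℝ u x‖ with hN
      have hN0 : 0 ≤ N := norm_nonneg _
      have hBy : B y = 1 := Set.indicator_of_mem (by simpa using hy.le) _
      have hhx : h x = N ^ 2 := Set.indicator_of_mem (by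
        rw [Metric.mem_closedBall, dist_eq_norm, hxdef, add_sub_cancel_left, norm_smul,
          norm_of_nonneg hσ.le]; nlinarith) _
      have hGx : fderiv ℝ Gσ y = σ • fderiv ℝ u x := by
        rw [hGσ, fderiv_comp_affine, (hnear y hy.le).fderiv_eq]
      have hterm : ∀ i ∈ (Finset.univ : Finset (Fin n)),
          fderiv ℝ φ y (EuclideanSpace.single i 1) * fderiv ℝ Gσ y (EuclideanSpace.single i 1)
            ≤ M * (σ * N) := by
        intro i _
        have hs : ‖(EuclideanSpace.single i 1 : Eu n)‖ = 1 := by simp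
        have a1 : |fderiv ℝ φ y (EuclideanSpace.single i 1)| ≤ M := by
          have := (fderiv ℝ φ y).le_opNorm (EuclideanSpace.single i 1)
          rw [hs, mul_one] at this
          exact this.trans (hM' y)
        have a2 : |fderiv ℝ Gσ y (EuclideanSpace.single i 1)| ≤ σ * N := by
          have := (fderiv ℝ Gσ y).le_opNorm (EuclideanSpace.single i 1)
          rw [hs, mul_one, hGx, norm_smul, norm_of_nonneg hσ.le] at this
          rw [hGx]
          exact this
        refine (le_abs_self _).trans ?_
        rw [abs_mul]
        exact mul_le_mul a1 a2 (abs_nonneg _) hM0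
      have hsum : T y ≤ n * (M * (σ * N)) := by
        have := Finset.sum_le_card_nsmul _ _ _ hterm
        simpa using this
      have hqx : σ * q x ≤ N := by
        have h1 : fderiv ℝ u x x ≤ N * ‖x‖ := (le_abs_self _).trans ((fderiv ℝ u x).le_opNorm x)
        have h2 : q x ≤ N / ‖x‖ := by
          simp only [hq]
          rw [div_le_div_iff₀ (by positivity) hxpos]
          nlinarith
        calc σ * q x ≤ σ * (N / ‖x‖) := by gcongr
          _ = N * (σ / ‖x‖) := by ring
          _ ≤ N * 1 := by gcongr; exact (div_le_one hxpos).2 hx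
          _ = N := mul_one N
      have h2 : 2 * a * σ ^ 2 * (q x * φ y) ≤ 2 * a * M * (σ * N) := by
        have h3 : σ * q x * φ y ≤ N * M := by
          calc σ * q x * φ y ≤ N * φ y := by gcongr; exact hφ0 y
            _ ≤ N * M := by gcongr; exact hM y
        have h4 : 2 * a * σ * (σ * q x * φ y) ≤ 2 * a * σ * (N * M) := by gcongr
        linarith
      have h5 : N ≤ κ * 1 + κ⁻¹ * N ^ 2 := by
        have : 0 ≤ κ⁻¹ * (N - κ) ^ 2 := by positivity
        have h6 : κ⁻¹ * (N - κ) ^ 2 = κ⁻¹ * N ^ 2 - 2 * N + κ := by field_simp; ring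
        linarith
      rw [hBy, hhx]
      have h7 : (n + 2 * a) * M * σ * N ≤ (n + 2 * a) * M * σ * (κ * 1 + κ⁻¹ * N ^ 2) := by
        gcongr
      linarith
  have e4 := integral_mono (hint2.add (hqi.const_mul (2 * a * σ ^ 2)))
    (((hBi.const_mul κ).add (hhσ.const_mul κ⁻¹)).const_mul ((n + 2 * a) * M * σ)) e3
  simp only [Pi.add_apply] at e4
  rw [← e2, integral_const_mul, integral_add (hBi.const_mul κ) (hhσ.const_mul κ⁻¹),
    integral_const_mul, integral_const_mul, hBint, hhint] at e4
  refine le_of_mul_le_mul_left (a := σ) ?_ hσ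
  linarith

end LocalEstimates

section CoreEstimate

variable {n : ℕ}

lemma rpow_le_four_rpow_abs {t : ℝ} (h1 : 1 / 4 ≤ t) (h2 : t ≤ 4) (e : ℝ) : t ^ e ≤ 4 ^ |e| := by
  have ht : 0 < t := by linarith
  rcases le_total 0 e with he | he
  · rw [abs_of_nonneg he]
    exact Real.rpow_le_rpow ht.le h2 he
  · rw [abs_of_nonpos he, ← neg_neg e, Real.rpow_neg ht.le, neg_neg, ← Real.inv_rpow ht.le]
    refine Real.rpow_le_rpow (by positivity) ?_ (by linarith)
    rw [inv_le_comm₀ ht (by norm_num)]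
    linarith

lemma inv_four_rpow_abs_le {t : ℝ} (h1 : 1 / 4 ≤ t) (h2 : t ≤ 4) (e : ℝ) :
    (4 ^ |e|)⁻¹ ≤ t ^ e := by
  have ht : 0 < t := by linarith
  have := rpow_le_four_rpow_abs h1 h2 (-e)
  rw [abs_neg, Real.rpow_neg ht.le] at this
  exact inv_le_of_inv_le₀ (by positivity) this

set_option maxHeartbeats 400000 in
/-- Mean value inequality for a function satisfying a differential inequality near the unit
sphere. -/
lemma exists_mul_le_integral_mul_bump {φ ψ : Eu n → ℝ} (hφ : ContDiff ℝ 1 φ)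
    (hψ : ContDiff ℝ 1 ψ) (hφ0 : ∀ y, 0 ≤ φ y)
    (hψ0 : ∀ y, 0 ≤ ψ y) (hφ1 : ∀ y, 1 ≤ ‖y‖ → φ y = 0)
    (hψ1 : ∀ y, 1 ≤ ‖y‖ → ψ y = 0) (hψφ : ∀ y v, fderiv ℝ ψ y v = -(φ y * inner ℝ y v))
    (hφpos : 0 < ∫ y, φ y) {a k p D A : ℝ} (ha : 0 ≤ a) (hD : 0 ≤ D) (hA : 0 ≤ A) (hp : 2 < p) :
    ∃ c > 0, ∃ θ > 0, ∀ U F : Eu n → ℝ, (∀ x, x ≠ 0 → ContDiffAt ℝ 2 U x) →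
      (∀ x, x ≠ 0 → 0 < U x) → (∀ x, x ≠ 0 → F x ≤ D * U x ^ (p - 1)) →
      (∀ x, x ≠ 0 → lapl U x - 2 * a * fderiv ℝ U x x / ‖x‖ ^ 2 = -(‖x‖ ^ k * F x)) →
      ∀ (z : Eu n) (σ : ℝ), 1 / 2 ≤ ‖z‖ → ‖z‖ ≤ 3 / 2 → 0 < σ → σ ≤ 1 / 8 →
      (∀ x, ‖x - z‖ ≤ σ → U x ≤ A * U z) → σ ^ 2 * (U z ^ (p - 2) + 1) ≤ θ →
      c * U z ≤ ∫ y, U (z + σ • y) * φ y := by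
  set Φ := ∫ y, φ y with hΦ
  set Ψ := ∫ y, ψ y with hΨ
  have hΨ0 : 0 ≤ Ψ := integral_nonneg hψ0
  set Pa : ℝ := 4 ^ |-a| with hPa
  set Pk : ℝ := 4 ^ |k| with hPk
  have hPa0 : 0 < Pa := by positivity
  have hPk0 : 0 < Pk := by positivity
  set K := Pa * (Pk * (D * A ^ (p - 1)) + 16 * (a * n * A)) with hK
  have hK0 : 0 ≤ K := by positivity
  refine ⟨Φ / (2 * Pa ^ 2), by positivity, Φ / (Pa * (K * Ψ + 1)), by positivity, ?_⟩
  intro U F hU hU0 hF heq z σ hz1 hz2 hσ hσ8 hUA hσθ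
  have hσz : 3 * σ < ‖z‖ := by linarith
  have hz0 : z ≠ 0 := norm_pos_iff.1 (by linarith)
  set m := U z with hm
  have hm0 : 0 < m := hU0 z hz0
  have hbd : ∀ x : Eu n, ‖x - z‖ ≤ σ → 1 / 4 ≤ ‖x‖ ∧ ‖x‖ ≤ 4 ∧ x ≠ 0 := fun x hx => by
    have h1 : ‖z‖ ≤ ‖x‖ + ‖x - z‖ := by
      have := norm_sub_le x (x - z)
      rwa [sub_sub_cancel] at this
    have h2 : ‖x‖ ≤ ‖z‖ + ‖x - z‖ := by
      have := norm_add_le z (x - z)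
      rwa [add_sub_cancel] at this
    exact ⟨by linarith, by linarith, norm_pos_iff.1 (by linarith)⟩
  have hH : ∀ x : Eu n, x ≠ 0 → ContDiffAt ℝ 2 (fun y => ‖y‖ ^ (-a) * U y) x := fun x hx =>
    (contDiffAt_norm_rpow hx _).mul (hU x hx)
  obtain ⟨G, hG, hGc, hGH⟩ := exists_contDiff_eq_near hH hσ hσz
  have hlap : ∀ x, ‖x - z‖ ≤ σ → -(K * (m ^ (p - 1) + m)) ≤ lapl G x := by
    intro x hx
    obtain ⟨hx1, hx4, hx0⟩ := hbd x hx
    have hpos : 0 < ‖x‖ := norm_pos_iff.2 hx0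
    rw [lapl_congr (hGH x hx), lapl_norm_rpow_mul hx0 _ (hU x hx0)]
    have h1 := heq x hx0
    have h2 : lapl U x + 2 * -a * fderiv ℝ U x x / ‖x‖ ^ 2 + -a * (-a + n - 2) * U x / ‖x‖ ^ 2
        = -(‖x‖ ^ k * F x + a * (n - 2 - a) * (U x / ‖x‖ ^ 2)) := by
      linear_combination h1
    rw [h2]
    have hUx := hU0 x hx0
    have hUA' := hUA x hx
    have h3 : ‖x‖ ^ k * F x ≤ Pk * (D * A ^ (p - 1) * m ^ (p - 1)) := by
      calc ‖x‖ ^ k * F x ≤ ‖x‖ ^ k * (D * U x ^ (p - 1)) := by gcongr; exact hF x hx0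
        _ ≤ Pk * (D * (A * m) ^ (p - 1)) := by
          gcongr
          · exact rpow_le_four_rpow_abs hx1 hx4 k
          · linarith
        _ = _ := by rw [Real.mul_rpow hA hm0.le]; ring
    have h4 : U x / ‖x‖ ^ 2 ≤ 16 * (A * m) := by
      rw [div_le_iff₀ (by positivity)]
      have : 1 / 16 ≤ ‖x‖ ^ 2 := by nlinarith
      nlinarith [mul_le_mul_of_nonneg_left this (hUx.le.trans hUA')]
    have h5 : a * (n - 2 - a) * (U x / ‖x‖ ^ 2) ≤ a * n * (16 * (A * m)) := by
      have : 0 ≤ U x / ‖x‖ ^ 2 := by positivity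
      calc a * (n - 2 - a) * (U x / ‖x‖ ^ 2) ≤ a * n * (U x / ‖x‖ ^ 2) := by
            gcongr; linarith
        _ ≤ _ := by gcongr
    have h6 : ‖x‖ ^ k * F x + a * (n - 2 - a) * (U x / ‖x‖ ^ 2)
        ≤ (Pk * (D * A ^ (p - 1)) + 16 * (a * n * A)) * (m ^ (p - 1) + m) := by
      have h7 : 0 ≤ Pk * (D * A ^ (p - 1)) * m := by positivity
      have h8 : 0 ≤ a * n * A * m ^ (p - 1) := by positivity
      linarith
    have h9 : 0 ≤ (Pk * (D * A ^ (p - 1)) + 16 * (a * n * A)) * (m ^ (p - 1) + m) := by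
      positivity
    have h10 := rpow_le_four_rpow_abs hx1 hx4 (-a)
    have h11 : 0 < ‖x‖ ^ (-a) := by positivity
    have h12 : ‖x‖ ^ (-a) * (‖x‖ ^ k * F x + a * (n - 2 - a) * (U x / ‖x‖ ^ 2))
        ≤ Pa * ((Pk * (D * A ^ (p - 1)) + 16 * (a * n * A)) * (m ^ (p - 1) + m)) := by
      calc _ ≤ ‖x‖ ^ (-a) * ((Pk * (D * A ^ (p - 1)) + 16 * (a * n * A)) * (m ^ (p - 1) + m)) := by
            gcongr
        _ ≤ _ := by gcongr
    rw [hK]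
    linarith
  have hMV := mul_integral_le_of_le_lapl hφ hψ hψ0 hφ1 hψ1 hψφ hG hGc hσ hlap
  have hnear : ∀ y : Eu n, ‖y‖ ≤ 1 → ‖z + σ • y - z‖ ≤ σ := fun y hy => by
    rw [add_sub_cancel_left, norm_smul, norm_of_nonneg hσ.le]; nlinarith
  have hGz : m / Pa ≤ G z := by
    rw [(hGH z (by simpa using hσ.le)).self_of_nhds, div_eq_inv_mul]
    change Pa⁻¹ * m ≤ ‖z‖ ^ (-a) * m
    gcongr
    exact inv_four_rpow_abs_le (by linarith) (by linarith) (-a)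
  have hφc : HasCompactSupport φ :=
    HasCompactSupport.intro (isCompact_closedBall 0 1) fun y hy => hφ1 y (by
      simp at hy; exact hy.le)
  have hUi := integrable_comp_affine_mul (fun x hx => (hU x hx).continuousAt) hφ.continuous hφ1
    hσ hσz
  have hGi : Integrable fun y => G (z + σ • y) * φ y :=
    ((hG.continuous.comp (by fun_prop : Continuous fun y : Eu n => z + σ • y)).mul
      hφ.continuous).integrable_of_hasCompactSupport hφc.mul_left
  have hGU : ∫ y, G (z + σ • y) * φ y ≤ Pa * ∫ y, U (z + σ • y) * φ y := by
    rw [← integral_const_mul]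
    refine integral_mono hGi (hUi.const_mul Pa) fun y => ?_
    rcases le_or_gt 1 ‖y‖ with hy | hy
    · simp [hφ1 y hy]
    · obtain ⟨hx1, hx4, hx0⟩ := hbd _ (hnear y hy.le)
      simp only
      rw [(hGH _ (hnear y hy.le)).self_of_nhds, mul_assoc]
      have := hU0 _ hx0
      have := hφ0 y
      gcongr
      exact rpow_le_four_rpow_abs hx1 hx4 (-a)
  have hmp : m ^ (p - 1) = m * m ^ (p - 2) := by
    rw [← Real.rpow_one_add' hm0.le (by linarith)]; congr 1; ring
  have hrem : K * (m ^ (p - 1) + m) * σ ^ 2 / 2 * Ψ ≤ m * Φ / (2 * Pa) := by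
    calc K * (m ^ (p - 1) + m) * σ ^ 2 / 2 * Ψ
        = K * Ψ * m / 2 * (σ ^ 2 * (m ^ (p - 2) + 1)) := by rw [hmp]; ring
      _ ≤ (K * Ψ + 1) * m / 2 * (Φ / (Pa * (K * Ψ + 1))) := by gcongr; linarith
      _ = m * Φ / (2 * Pa) := by field_simp
  have h1 : m / Pa * Φ ≤ G z * Φ := by gcongr
  have h2 : m * Φ / (2 * Pa) ≤ Pa * ∫ y, U (z + σ • y) * φ y := by
    have h3 : m / Pa * Φ = m * Φ / (2 * Pa) + m * Φ / (2 * Pa) := by field_simp; ring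
    linarith
  calc Φ / (2 * Pa ^ 2) * m = (m * Φ / (2 * Pa)) / Pa := by field_simp
    _ ≤ _ := by rwa [div_le_iff₀' hPa0]

lemma le_add_rpow_mul_rpow {p t T : ℝ} (hp : 2 < p) (ht : 0 < t) (hT : 0 < T) :
    t ≤ T + T ^ (-(p - 2)) * t ^ (p - 1) := by
  rcases le_total t T with h | h
  · have : 0 ≤ T ^ (-(p - 2)) * t ^ (p - 1) := by positivity
    linarith
  · have h1 : t ^ (-(p - 2)) ≤ T ^ (-(p - 2)) :=
      Real.rpow_le_rpow_of_nonpos hT h (by linarith)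
    have h2 : t ^ (-(p - 2)) * t ^ (p - 1) = t := by
      rw [← Real.rpow_add ht]; ring_nf; exact Real.rpow_one t
    have h3 : t ^ (-(p - 2)) * t ^ (p - 1) ≤ T ^ (-(p - 2)) * t ^ (p - 1) := by gcongr
    linarith

/-- Lower bound of the Dirichlet energy of a solution near a point of almost maximal value. -/
lemma exists_rpow_mul_pow_le_energy (hn : 1 ≤ n) {a k p α β c d A : ℝ} (ha : 0 ≤ a) (hc : 0 ≤ c)
    (hd : 0 ≤ d) (hα : 1 < α) (hβ : 1 < β) (hp : α + β = p) (hA : 0 ≤ A) :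
    ∃ C > 0, ∃ θ > 0, ∀ u v : Eu n → ℝ, (∀ x, x ≠ 0 → ContDiffAt ℝ 2 u x) →
      (∀ x, x ≠ 0 → ContDiffAt ℝ 2 v x) → (∀ x, x ≠ 0 → 0 < u x) → (∀ x, x ≠ 0 → 0 < v x) →
      (∀ x, x ≠ 0 → lapl u x - 2 * a * fderiv ℝ u x x / ‖x‖ ^ 2
        = -(‖x‖ ^ k * coupling p c α β (u x) (v x))) →
      (∀ x, x ≠ 0 → lapl v x - 2 * a * fderiv ℝ v x x / ‖x‖ ^ 2
        = -(‖x‖ ^ k * coupling p d β α (v x) (u x))) →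
      ∀ (z : Eu n) (σ : ℝ), 1 / 2 ≤ ‖z‖ → ‖z‖ ≤ 3 / 2 → 0 < σ → σ ≤ 1 / 8 →
      (∀ x, ‖x - z‖ ≤ σ → u x + v x ≤ A * (u z + v z)) →
      σ ^ 2 * ((u z + v z) ^ (p - 2) + 1) ≤ θ →
      ((u z + v z) ^ (p - 1)) ^ 2 * σ ^ (n + 2) ≤
        C * ((∫ x in Metric.closedBall z σ, ‖fderiv ℝ u x‖ ^ 2)
          + ∫ x in Metric.closedBall z σ, ‖fderiv ℝ v x‖ ^ 2) := by
  have hp2 : 2 < p := by linarith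
  obtain ⟨φ, ψ, hφ, hψ, hφ0, hψ0, hφ1, hψ1, hψφ, hφpos⟩ := exists_bump (n := n) hn
  have hφc : HasCompactSupport φ :=
    HasCompactSupport.intro (isCompact_closedBall 0 1) fun y hy => hφ1 y (by
      simp at hy; exact hy.le)
  have hφi : Integrable φ := hφ.continuous.integrable_of_hasCompactSupport hφc
  obtain ⟨M₁, hM₁⟩ := hφ.continuous.bounded_above_of_compact_support hφc
  obtain ⟨M₂, hM₂⟩ := (hφ.continuous_fderiv (by simp)).bounded_above_of_compact_support
    (hφc.fderiv (𝕜 := ℝ))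
  set M := max 1 (max M₁ M₂) with hMdef
  have hM : ∀ y, φ y ≤ M := fun y =>
    (le_abs_self _).trans ((hM₁ y).trans ((le_max_left _ _).trans (le_max_right _ _)))
  have hM' : ∀ y, ‖fderiv ℝ φ y‖ ≤ M := fun y =>
    (hM₂ y).trans ((le_max_right _ _).trans (le_max_right _ _))
  have hM0 : 0 < M := lt_of_lt_of_le one_pos (le_max_left _ _)
  obtain ⟨c₁, hc₁, θ, hθ, hmv⟩ := exists_mul_le_integral_mul_bump hφ hψ hφ0 hψ0 hφ1 hψ1 hψφ hφpos
    (k := k) (D := 2 + c + d) ha (by linarith) hA hp2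
  set Φ := ∫ y, φ y with hΦ
  set κ₀ := c₁ / (4 * Φ) with hκ₀
  have hκ₀pos : 0 < κ₀ := by positivity
  set c₂ := c₁ / 2 * κ₀ ^ (p - 2) with hc₂
  have hc₂pos : 0 < c₂ := by positivity
  set V := volume.real (Metric.closedBall (0 : Eu n) 1) with hV
  have hV0 : 0 < V := by
    rw [hV, measureReal_def]
    exact ENNReal.toReal_pos (Metric.measure_closedBall_pos _ _ one_pos).ne'
      measure_closedBall_lt_top.ne
  set P : ℝ := 4 ^ |k| with hP
  have hP0 : 0 < P := by positivity
  set C₁ := (n + 2 * a) * M with hC₁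
  have hn' : (1 : ℝ) ≤ n := by exact_mod_cast hn
  have hC₁0 : 0 < C₁ := by positivity
  refine ⟨8 * P ^ 2 * C₁ ^ 2 * V / c₂ ^ 2, by positivity, θ, hθ, ?_⟩
  intro u v hu hv hu0 hv0 hueq hveq z σ hz1 hz2 hσ hσ8 hA' hσθ
  have hσz : 3 * σ < ‖z‖ := by linarith
  have hz0 : z ≠ 0 := norm_pos_iff.1 (by linarith)
  have hx0 : ∀ y : Eu n, ‖y‖ < 1 → 1 / 4 ≤ ‖z + σ • y‖ ∧ ‖z + σ • y‖ ≤ 4 := fun y hy => by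
    have := norm_affine_bounds (z := z) hσ hy.le
    constructor <;> linarith [this.1, this.2]
  set m := u z + v z with hm
  have hm0 : 0 < m := add_pos (hu0 z hz0) (hv0 z hz0)
  have hmean := hmv (fun x => u x + v x)
    (fun x => coupling p c α β (u x) (v x) + coupling p d β α (v x) (u x))
    (fun x hx => (hu x hx).add (hv x hx)) (fun x hx => add_pos (hu0 x hx) (hv0 x hx))
    (fun x hx => by
      have h1 := coupling_le hc hα hβ hp (hu0 x hx) (hv0 x hx)
      have h2 := coupling_le hd hβ hα (by linarith : β + α = p) (hv0 x hx) (hu0 x hx)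
      rw [add_comm (v x) (u x)] at h2
      linarith)
    (fun x hx => by
      rw [lapl_add (hu x hx) (hv x hx), fderiv_fun_add ((hu x hx).differentiableAt (by simp))
        ((hv x hx).differentiableAt (by simp)), add_apply]
      linear_combination hueq x hx + hveq x hx)
    z σ hz1 hz2 hσ hσ8 hA' hσθ
  simp only [← hm] at hmean
  have hpow : ∀ f : Eu n → ℝ, (∀ x, x ≠ 0 → ContDiffAt ℝ 2 f x) → (∀ x, x ≠ 0 → 0 < f x) →
      Integrable (fun y => f (z + σ • y) ^ (p - 1) * φ y) := fun f hf hf0 =>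
    integrable_comp_affine_mul (f := fun x => f x ^ (p - 1))
      (fun x hx => (hf x hx).continuousAt.rpow_const (Or.inl (hf0 x hx).ne')) hφ.continuous hφ1
      hσ hσz
  set T := κ₀ * m with hT
  have hT0 : 0 < T := by positivity
  have hlow : c₂ * m ^ (p - 1) ≤ (∫ y, u (z + σ • y) ^ (p - 1) * φ y)
      + ∫ y, v (z + σ • y) ^ (p - 1) * φ y := by
    set Su := ∫ y, u (z + σ • y) ^ (p - 1) * φ y with hSu
    set Sv := ∫ y, v (z + σ • y) ^ (p - 1) * φ y with hSv
    have hsum : Integrable fun y => u (z + σ • y) ^ (p - 1) * φ y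
        + v (z + σ • y) ^ (p - 1) * φ y := (hpow u hu hu0).add (hpow v hv hv0)
    have h1 : ∫ y, (u (z + σ • y) + v (z + σ • y)) * φ y
        ≤ 2 * T * Φ + T ^ (-(p - 2)) * (Su + Sv) := by
      have h2 : 2 * T * Φ + T ^ (-(p - 2)) * (Su + Sv)
          = ∫ y, (2 * T * φ y + T ^ (-(p - 2)) * (u (z + σ • y) ^ (p - 1) * φ y
            + v (z + σ • y) ^ (p - 1) * φ y)) := by
        rw [integral_add (hφi.const_mul _) (hsum.const_mul _),
          integral_const_mul, integral_const_mul, integral_add (hpow u hu hu0) (hpow v hv hv0)]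
      rw [h2]
      refine integral_mono (integrable_comp_affine_mul (f := fun x => u x + v x)
        (fun x hx => (hu x hx).continuousAt.add (hv x hx).continuousAt) hφ.continuous hφ1 hσ hσz)
        ((hφi.const_mul _).add (hsum.const_mul _)) fun y => ?_
      rcases le_or_gt 1 ‖y‖ with hy | hy
      · simp [hφ1 y hy]
      · have hne : z + σ • y ≠ 0 := norm_pos_iff.1 (by linarith [(hx0 y hy).1])
        have h3 := le_add_rpow_mul_rpow hp2 (hu0 _ hne) hT0
        have h4 := le_add_rpow_mul_rpow hp2 (hv0 _ hne) hT0
        have h5 := mul_le_mul_of_nonneg_right (add_le_add h3 h4) (hφ0 y)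
        linarith
    have h2 : 2 * T * Φ = c₁ * m / 2 := by
      rw [hT, hκ₀]; field_simp; ring
    have h3 : c₁ * m / 2 ≤ T ^ (-(p - 2)) * (Su + Sv) := by linarith
    have h4 : T ^ (p - 2) * T ^ (-(p - 2)) = 1 := by
      rw [← Real.rpow_add hT0]; simp
    have hmp : m ^ (p - 1) = m * m ^ (p - 2) := by
      rw [← Real.rpow_one_add' hm0.le (by linarith)]; congr 1; ring
    calc c₂ * m ^ (p - 1) = T ^ (p - 2) * (c₁ * m / 2) := by
          rw [hmp, hc₂, hT, Real.mul_rpow hκ₀pos.le hm0.le]; ring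
      _ ≤ T ^ (p - 2) * (T ^ (-(p - 2)) * (Su + Sv)) := by gcongr
      _ = Su + Sv := by rw [← mul_assoc, h4, one_mul]
  set κ := σ * c₂ * m ^ (p - 1) / (4 * P * C₁ * V) with hκ
  have hκ0 : 0 < κ := by positivity
  have hup : ∀ (f g : Eu n → ℝ) (e α' β' : ℝ), 0 ≤ e → (∀ x, x ≠ 0 → ContDiffAt ℝ 2 f x) →
      (∀ x, x ≠ 0 → ContDiffAt ℝ 2 g x) → (∀ x, x ≠ 0 → 0 < f x) → (∀ x, x ≠ 0 → 0 < g x) →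
      (∀ x, x ≠ 0 → lapl f x - 2 * a * fderiv ℝ f x x / ‖x‖ ^ 2
        = -(‖x‖ ^ k * coupling p e α' β' (f x) (g x))) →
      σ * ∫ y, f (z + σ • y) ^ (p - 1) * φ y ≤ P * (C₁ * (κ * V
        + (σ ^ n)⁻¹ * κ⁻¹ * ∫ x in Metric.closedBall z σ, ‖fderiv ℝ f x‖ ^ 2)) := by
    intro f g e α' β' he hf hg hf0 hg0 hfeq
    have h1 := integral_rhs_mul_le hφ hφ0 hφ1 hM hM' ha hf hfeq hσ hσz hκ0
    have hci : Integrable fun y =>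
        ‖z + σ • y‖ ^ k * coupling p e α' β' (f (z + σ • y)) (g (z + σ • y)) * φ y := by
      refine integrable_comp_affine_mul
        (f := fun x => ‖x‖ ^ k * coupling p e α' β' (f x) (g x)) (fun x hx => ?_)
        hφ.continuous hφ1 hσ hσz
      have hfx := (hf x hx).continuousAt
      have hgx := (hg x hx).continuousAt
      have hfn := (hf0 x hx).ne'
      have hgn := (hg0 x hx).ne'
      unfold coupling
      exact (continuous_norm.continuousAt.rpow_const (Or.inl (norm_ne_zero_iff.2 hx))).mul
        ((hfx.rpow_const (Or.inl hfn)).add ((continuousAt_const.mul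
          (hfx.rpow_const (Or.inl hfn))).mul (hgx.rpow_const (Or.inl hgn))))
    have h2 : ∫ y, f (z + σ • y) ^ (p - 1) * φ y ≤ P * ∫ y,
        ‖z + σ • y‖ ^ k * coupling p e α' β' (f (z + σ • y)) (g (z + σ • y)) * φ y := by
      rw [← integral_const_mul]
      refine integral_mono (hpow f hf hf0) (hci.const_mul P) fun y => ?_
      rcases le_or_gt 1 ‖y‖ with hy | hy
      · simp [hφ1 y hy]
      · have hb := hx0 y hy
        have hne : z + σ • y ≠ 0 := norm_pos_iff.1 (by linarith [hb.1])
        have h3 := rpow_le_coupling (p := p) (α := α') (β := β') he (hf0 _ hne) (hg0 _ hne)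
        have h4 := inv_four_rpow_abs_le hb.1 hb.2 k
        have h5 : 1 ≤ P * ‖z + σ • y‖ ^ k := by
          rwa [inv_le_iff_one_le_mul₀' hP0] at h4
        have h6 : 0 ≤ f (z + σ • y) ^ (p - 1) := (Real.rpow_pos_of_pos (hf0 _ hne) _).le
        simp only
        rw [← mul_assoc, ← mul_assoc]
        refine mul_le_mul_of_nonneg_right ?_ (hφ0 y)
        nlinarith
    calc σ * ∫ y, f (z + σ • y) ^ (p - 1) * φ y ≤ σ * (P * ∫ y,
        ‖z + σ • y‖ ^ k * coupling p e α' β' (f (z + σ • y)) (g (z + σ • y)) * φ y) := by gcongr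
      _ = P * (σ * ∫ y,
        ‖z + σ • y‖ ^ k * coupling p e α' β' (f (z + σ • y)) (g (z + σ • y)) * φ y) := by ring
      _ ≤ _ := by gcongr
  have hupu := hup u v c α β hc hu hv hu0 hv0 hueq
  have hupv := hup v u d β α hd hv hu hv0 hu0 hveq
  set Iu := ∫ x in Metric.closedBall z σ, ‖fderiv ℝ u x‖ ^ 2 with hIu
  set Iv := ∫ x in Metric.closedBall z σ, ‖fderiv ℝ v x‖ ^ 2 with hIv
  set Q := σ * c₂ * m ^ (p - 1) with hQ
  have hQ0 : 0 < Q := by positivity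
  have h1 : Q ≤ P * C₁ * (2 * κ * V + (σ ^ n)⁻¹ * κ⁻¹ * (Iu + Iv)) := by
    have := mul_le_mul_of_nonneg_left hlow hσ.le
    linarith
  have h2 : P * C₁ * (2 * κ * V) = Q / 2 := by
    rw [hκ]; field_simp; ring
  have h3 : Q / 2 ≤ P * C₁ * ((σ ^ n)⁻¹ * κ⁻¹ * (Iu + Iv)) := by linarith
  have h4 : P * C₁ * ((σ ^ n)⁻¹ * κ⁻¹ * (Iu + Iv))
      = 4 * P ^ 2 * C₁ ^ 2 * V * (Iu + Iv) / (σ ^ n * Q) := by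
    rw [hκ]; field_simp
  rw [h4, le_div_iff₀ (by positivity)] at h3
  have h5 : (m ^ (p - 1)) ^ 2 * σ ^ (n + 2) = Q / 2 * (σ ^ n * Q) * (2 / c₂ ^ 2) := by
    rw [hQ]; field_simp; ring
  rw [h5]
  calc _ ≤ 4 * P ^ 2 * C₁ ^ 2 * V * (Iu + Iv) * (2 / c₂ ^ 2) := by gcongr
    _ = _ := by ring

end CoreEstimate

section SmallEnergy

variable {n : ℕ}

/-- Positive `C²` solutions on the punctured space, the equations being in non-divergence form. -/
structure IsPositiveSolution (a k p α β c d : ℝ) (u v : Eu n → ℝ) : Prop where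
  contDiffAt_left : ∀ x, x ≠ 0 → ContDiffAt ℝ 2 u x
  contDiffAt_right : ∀ x, x ≠ 0 → ContDiffAt ℝ 2 v x
  pos_left : ∀ x, x ≠ 0 → 0 < u x
  pos_right : ∀ x, x ≠ 0 → 0 < v x
  eq_left : ∀ x, x ≠ 0 → lapl u x - 2 * a * fderiv ℝ u x x / ‖x‖ ^ 2
    = -(‖x‖ ^ k * coupling p c α β (u x) (v x))
  eq_right : ∀ x, x ≠ 0 → lapl v x - 2 * a * fderiv ℝ v x x / ‖x‖ ^ 2
    = -(‖x‖ ^ k * coupling p d β α (v x) (u x))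

lemma exists_max_pow_mul {U : Eu n → ℝ} (hn : n ≠ 0) {e : Eu n} {R : ℝ} (hR : 0 < R)
    (hU : ContinuousOn U (Metric.closedBall e R)) (hU0 : ∀ x ∈ Metric.closedBall e R, 0 < U x) :
    ∃ z δ, 0 < δ ∧ δ ≤ R ∧ ‖z - e‖ = R - δ ∧ U e ≤ U z ∧ R ^ n * U e ≤ δ ^ n * U z ∧
      ∀ x, ‖x - z‖ ≤ δ / 2 → U x ≤ 2 ^ n * U z := by
  have he : e ∈ Metric.closedBall e R := Metric.mem_closedBall_self hR.le
  obtain ⟨z, hz, hmax⟩ := (isCompact_closedBall e R).exists_isMaxOn ⟨e, he⟩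
    (f := fun y => (R - ‖y - e‖) ^ n * U y)
    (ContinuousOn.mul (by fun_prop) hU)
  have hze : ‖z - e‖ ≤ R := by rwa [Metric.mem_closedBall, dist_eq_norm] at hz
  have h1 : R ^ n * U e ≤ (R - ‖z - e‖) ^ n * U z := by simpa using hmax he
  have hUe := hU0 e he
  have hUz := hU0 z hz
  have hδ : 0 < R - ‖z - e‖ := by
    rcases hze.lt_or_eq with h | h
    · linarith
    · rw [h, sub_self, zero_pow hn, zero_mul] at h1
      have : 0 < R ^ n * U e := by positivity
      linarith
  have hδR : R - ‖z - e‖ ≤ R := by linarith [norm_nonneg (z - e)]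
  refine ⟨z, R - ‖z - e‖, hδ, hδR, by ring, ?_, h1, fun x hx => ?_⟩
  · have h2 : (R - ‖z - e‖) ^ n * U z ≤ R ^ n * U z := by gcongr
    exact le_of_mul_le_mul_left (h1.trans h2) (by positivity)
  · have h2 : ‖x - e‖ ≤ ‖x - z‖ + ‖z - e‖ := norm_sub_le_norm_sub_add_norm_sub x z e
    have hx' : x ∈ Metric.closedBall e R := by
      rw [Metric.mem_closedBall, dist_eq_norm]; linarith
    have h3 : (R - ‖x - e‖) ^ n * U x ≤ (R - ‖z - e‖) ^ n * U z := hmax hx'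
    have hUx := hU0 x hx'
    have h4 : ((R - ‖z - e‖) / 2) ^ n * U x ≤ (R - ‖x - e‖) ^ n * U x := by
      gcongr
      linarith
    rw [div_pow, div_mul_eq_mul_div, div_le_iff₀ (by positivity)] at h4
    have h5 : (R - ‖z - e‖) ^ n * U x ≤ (R - ‖z - e‖) ^ n * (2 ^ n * U z) := by
      have : (R - ‖x - e‖) ^ n * U x * 2 ^ n ≤ (R - ‖z - e‖) ^ n * U z * 2 ^ n := by gcongr
      linarith
    exact le_of_mul_le_mul_left h5 (by positivity)

lemma integrableOn_norm_fderiv_sq {u : Eu n → ℝ} (hu : ∀ x, x ≠ 0 → ContDiffAt ℝ 2 u x)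
    {K : Set (Eu n)} (hK : IsCompact K) (hK0 : ∀ x ∈ K, x ≠ 0) :
    IntegrableOn (fun x => ‖fderiv ℝ u x‖ ^ 2) K :=
  ContinuousOn.integrableOn_compact hK fun x hx =>
    ((hu x (hK0 x hx)).differentiableAt_fderiv.continuousAt.norm.pow 2).continuousWithinAt

set_option maxHeartbeats 800000 in
/-- Small Dirichlet energy on a half-unit ball forces smallness at the centre. -/
lemma exists_le_of_energy_le (hn : 3 ≤ n) {a k p α β c d η : ℝ} (ha : 0 ≤ a) (hc : 0 ≤ c)
    (hd : 0 ≤ d) (hα : 1 < α) (hβ : 1 < β) (hp : α + β = p) (hpn : p * (n - 2) ≤ 2 * n)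
    (hη : 0 < η) :
    ∃ ε > 0, ∀ u v : Eu n → ℝ, IsPositiveSolution a k p α β c d u v → ∀ e : Eu n, ‖e‖ = 1 →
      (∫ x in Metric.closedBall e (1 / 2), ‖fderiv ℝ u x‖ ^ 2)
        + (∫ x in Metric.closedBall e (1 / 2), ‖fderiv ℝ v x‖ ^ 2) ≤ ε → u e + v e ≤ η := by
  have hp2 : 2 < p := by linarith
  obtain ⟨C, hC, θ, hθ, hcore⟩ := exists_rpow_mul_pow_le_energy (n := n) (by lia) (k := k)
    (A := 2 ^ n) ha hc hd hα hβ hp (by positivity)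
  set τ := min (1 / 4) θ with hτ
  have hτ0 : 0 < τ := by positivity
  have hτ4 : τ ≤ 1 / 4 := min_le_left _ _
  have hτθ : 2 * τ ^ 2 ≤ θ := by
    have h1 : τ ≤ θ := min_le_right _ _
    nlinarith
  set q := (2 * n - p * (n - 2)) / 2 with hq
  have hq0 : 0 ≤ q := by rw [hq]; linarith
  set L := min (τ ^ (n + 2) * (η ^ (p - 2) * (η * (1 / 2) ^ n)) ^ 2) (τ ^ (n + 2) * η ^ q) with hL
  have hL0 : 0 < L := by positivity
  refine ⟨L / (2 * C), by positivity, fun u v hs e he hE => ?_⟩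
  by_contra! hlt
  have hball : ∀ x ∈ Metric.closedBall e (1 / 2), 1 / 2 ≤ ‖x‖ ∧ ‖x‖ ≤ 3 / 2 ∧ x ≠ 0 := by
    intro x hx
    rw [Metric.mem_closedBall, dist_eq_norm] at hx
    have h1 : ‖e‖ ≤ ‖x‖ + ‖x - e‖ := by
      have := norm_sub_le x (x - e)
      rwa [sub_sub_cancel] at this
    have h2 : ‖x‖ ≤ ‖e‖ + ‖x - e‖ := by
      have := norm_add_le e (x - e)
      rwa [add_sub_cancel] at this
    exact ⟨by linarith, by linarith, norm_pos_iff.1 (by linarith)⟩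
  obtain ⟨z, δ, hδ, hδ2, hze, hUez, hδU, hUz⟩ := exists_max_pow_mul (U := fun x => u x + v x)
    (by lia) (e := e) (R := 1 / 2) (by norm_num)
    (fun x hx => ((hs.contDiffAt_left x (hball x hx).2.2).continuousAt.add
      (hs.contDiffAt_right x (hball x hx).2.2).continuousAt).continuousWithinAt)
    (fun x hx => add_pos (hs.pos_left x (hball x hx).2.2) (hs.pos_right x (hball x hx).2.2))
  have hzb : z ∈ Metric.closedBall e (1 / 2) := by
    rw [Metric.mem_closedBall, dist_eq_norm]; linarith
  set m := u z + v z with hm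
  have hηm : η < m := hlt.trans_le hUez
  have hm0 : 0 < m := hη.trans hηm
  set σ := τ * min δ (m ^ (-((p - 2) / 2))) with hσ
  have hσ0 : 0 < σ := by positivity
  have hσδ : σ ≤ τ * δ := by rw [hσ]; gcongr; exact min_le_left _ _
  have hσm : σ ≤ τ * m ^ (-((p - 2) / 2)) := by rw [hσ]; gcongr; exact min_le_right _ _
  have hσδ2 : σ ≤ δ / 2 := by nlinarith
  have hσ8 : σ ≤ 1 / 8 := by nlinarith
  have hsub : Metric.closedBall z σ ⊆ Metric.closedBall e (1 / 2) := by
    refine Metric.closedBall_subset_closedBall' ?_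
    rw [dist_eq_norm]; linarith
  have hσθ : σ ^ 2 * (m ^ (p - 2) + 1) ≤ θ := by
    have h1 : (m ^ (-((p - 2) / 2))) ^ 2 * m ^ (p - 2) = 1 := by
      rw [← Real.rpow_natCast, ← Real.rpow_mul hm0.le, ← Real.rpow_add hm0]
      push_cast
      ring_nf
      exact Real.rpow_zero m
    have h2 : σ ^ 2 * m ^ (p - 2) ≤ τ ^ 2 := by
      calc σ ^ 2 * m ^ (p - 2) ≤ (τ * m ^ (-((p - 2) / 2))) ^ 2 * m ^ (p - 2) := by gcongr
        _ = τ ^ 2 * ((m ^ (-((p - 2) / 2))) ^ 2 * m ^ (p - 2)) := by ring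
        _ = τ ^ 2 := by rw [h1, mul_one]
    have h3 : σ ^ 2 ≤ τ ^ 2 := by
      gcongr
      nlinarith
    linarith
  have hmain := hcore u v hs.contDiffAt_left hs.contDiffAt_right hs.pos_left hs.pos_right
    hs.eq_left hs.eq_right z σ (hball z hzb).1 (hball z hzb).2.1 hσ0 hσ8
    (fun x hx => hUz x (hx.trans hσδ2)) hσθ
  have hmono : ∀ f : Eu n → ℝ, (∀ x, x ≠ 0 → ContDiffAt ℝ 2 f x) →
      ∫ x in Metric.closedBall z σ, ‖fderiv ℝ f x‖ ^ 2
        ≤ ∫ x in Metric.closedBall e (1 / 2), ‖fderiv ℝ f x‖ ^ 2 := fun f hf =>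
    setIntegral_mono_set (integrableOn_norm_fderiv_sq hf (isCompact_closedBall _ _)
      fun x hx => (hball x hx).2.2) (Eventually.of_forall fun x => by positivity)
      (Eventually.of_forall hsub)
  have hup : (m ^ (p - 1)) ^ 2 * σ ^ (n + 2) ≤ L / 2 := by
    refine hmain.trans ?_
    calc _ ≤ C * (L / (2 * C)) := by
          gcongr
          exact (add_le_add (hmono u hs.contDiffAt_left) (hmono v hs.contDiffAt_right)).trans hE
      _ = L / 2 := by field_simp
  have hlow : L ≤ (m ^ (p - 1)) ^ 2 * σ ^ (n + 2) := by
    rcases le_total δ (m ^ (-((p - 2) / 2))) with h | h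
    · rw [hσ, min_eq_left h, mul_pow]
      have h1 : m ^ (p - 1) = m ^ (p - 2) * m := by
        rw [← Real.rpow_add_one' hm0.le (by linarith)]; congr 1; ring
      have h2 : (δ ^ n) ^ 2 ≤ δ ^ (n + 2) := by
        rw [← pow_mul]
        exact pow_le_pow_of_le_one hδ.le (by linarith) (by lia)
      have h3 : η * (1 / 2) ^ n ≤ m * δ ^ n := by
        have : (1 / 2) ^ n * η ≤ (1 / 2) ^ n * (u e + v e) := by gcongr
        linarith
      calc L ≤ τ ^ (n + 2) * (η ^ (p - 2) * (η * (1 / 2) ^ n)) ^ 2 := min_le_left _ _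
        _ ≤ τ ^ (n + 2) * (m ^ (p - 2) * (m * δ ^ n)) ^ 2 := by gcongr
        _ = (m ^ (p - 2) * m) ^ 2 * (τ ^ (n + 2) * (δ ^ n) ^ 2) := by ring
        _ ≤ _ := by rw [h1]; gcongr
    · rw [hσ, min_eq_right h, mul_pow]
      have h1 : (m ^ (p - 1)) ^ 2 * (m ^ (-((p - 2) / 2))) ^ (n + 2) = m ^ q := by
        rw [← Real.rpow_natCast, ← Real.rpow_natCast, ← Real.rpow_mul hm0.le,
          ← Real.rpow_mul hm0.le, ← Real.rpow_add hm0, hq]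
        congr 1
        push_cast
        ring
      calc L ≤ τ ^ (n + 2) * η ^ q := min_le_right _ _
        _ ≤ τ ^ (n + 2) * m ^ q := by gcongr
        _ = _ := by rw [← h1]; ring
  linarith

end SmallEnergy

section Decay

variable {n : ℕ}

lemma norm_gradient (u : Eu n → ℝ) (x : Eu n) : ‖gradient u x‖ = ‖fderiv ℝ u x‖ := by
  unfold gradient
  exact LinearIsometryEquiv.norm_map _ _

lemma norm_bounds_of_mem_closedBall_half {x y : Eu n}
    (h : y ∈ Metric.closedBall x (‖x‖ / 2)) : ‖x‖ / 2 ≤ ‖y‖ ∧ ‖y‖ ≤ 3 / 2 * ‖x‖ := by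
  rw [Metric.mem_closedBall, dist_eq_norm] at h
  have h1 : ‖x‖ ≤ ‖y‖ + ‖y - x‖ := by
    have := norm_sub_le y (y - x)
    rwa [sub_sub_cancel] at this
  have h2 : ‖y‖ ≤ ‖x‖ + ‖y - x‖ := by
    have := norm_add_le x (y - x)
    rwa [add_sub_cancel] at this
  constructor <;> linarith

/-- An integrable nonnegative function has small integral on balls `B(x, |x| / 2)` escaping to the
origin or to infinity. -/
lemma exists_setIntegral_le {s : ℝ} (hs : s = 1 ∨ s = -1) {h : Eu n → ℝ} (hi : Integrable h)
    (h0 : ∀ x, 0 ≤ h x) {ε : ℝ} (hε : 0 < ε) :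
    ∃ ρ > 0, ∀ x : Eu n, x ≠ 0 → ‖x‖ ^ s ≤ ρ →
      ∫ y in Metric.closedBall x (‖x‖ / 2), h y ≤ ε := by
  set S : ℕ → Set (Eu n) := fun i => {x | x ≠ 0 ∧ ‖x‖ ^ s ≤ 2 / (i + 1)} with hS
  have hSm : ∀ i, MeasurableSet (S i) := fun i => by
    refine MeasurableSet.inter (measurableSet_singleton 0).compl ?_
    exact measurableSet_le (f := fun x : Eu n => ‖x‖ ^ s) (measurable_norm.pow_const s)
      measurable_const
  have hanti : Antitone S := fun i j hij x hx =>
    ⟨hx.1, hx.2.trans (by gcongr)⟩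
  have hinter : ⋂ i, S i = ∅ := by
    refine Set.eq_empty_of_forall_notMem fun x hx => ?_
    rw [Set.mem_iInter] at hx
    have hpos := norm_rpow_pos (hx 0).1 s
    obtain ⟨i, hi⟩ := exists_nat_gt (2 / ‖x‖ ^ s)
    have h1 := (hx i).2
    rw [le_div_iff₀ (by positivity)] at h1
    rw [div_lt_iff₀ hpos] at hi
    nlinarith
  have hlim := tendsto_setIntegral_of_antitone hSm hanti ⟨0, hi.integrableOn (s := S 0)⟩
  rw [hinter, Measure.restrict_empty, integral_zero_measure] at hlim
  obtain ⟨i, hiε⟩ := (hlim.eventually_le_const hε).exists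
  refine ⟨1 / (i + 1), by positivity, fun x hx hxs => ?_⟩
  refine (setIntegral_mono_set hi.integrableOn (Eventually.of_forall h0)
    (Eventually.of_forall fun y hy => ?_)).trans hiε
  have hb := norm_bounds_of_mem_closedBall_half hy
  have hxpos : 0 < ‖x‖ := norm_pos_iff.2 hx
  have hypos : 0 < ‖y‖ := by linarith
  refine ⟨norm_pos_iff.1 hypos, ?_⟩
  have h1 : (2 : ℝ) / (i + 1) = 2 * (1 / (i + 1)) := by ring
  rw [h1]
  refine le_trans ?_ (mul_le_mul_of_nonneg_left hxs (by norm_num))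
  rcases hs with rfl | rfl
  · rw [Real.rpow_one, Real.rpow_one]; linarith
  · rw [Real.rpow_neg_one, Real.rpow_neg_one, ← div_eq_mul_inv, inv_le_comm₀ hypos (by positivity),
      inv_div]
    exact hb.1

variable {a b p α β c d γ : ℝ}

lemma equation_comp_smul (hγ : n - 2 - 2 * a = 2 * γ) (hpn : p * (b + γ) = n)
    (hp : α + β = p) {u v : Eu n → ℝ} (hu : ∀ x, x ≠ 0 → ContDiffAt ℝ 2 u x)
    (hu0 : ∀ x, x ≠ 0 → 0 < u x) (hv0 : ∀ x, x ≠ 0 → 0 < v x)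
    (heq : ∀ x, x ≠ 0 → lapl u x - 2 * a * fderiv ℝ u x x / ‖x‖ ^ 2
      = -(‖x‖ ^ (2 * a - b * p) * coupling p c α β (u x) (v x))) {R : ℝ} (hR : 0 < R)
    {y : Eu n} (hy : y ≠ 0) :
    lapl (fun y => R ^ γ * u (R • y)) y
        - 2 * a * fderiv ℝ (fun y => R ^ γ * u (R • y)) y y / ‖y‖ ^ 2
      = -(‖y‖ ^ (2 * a - b * p) * coupling p c α β (R ^ γ * u (R • y)) (R ^ γ * v (R • y))) := by
  have hRy : R • y ≠ 0 := smul_ne_zero hR.ne' hy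
  have hpos : 0 < ‖y‖ := norm_pos_iff.2 hy
  have hc : ContDiffAt ℝ 2 (fun y : Eu n => u (R • y)) y :=
    ContDiffAt.comp (g := u) y (hu _ hRy) (contDiff_const_smul R).contDiffAt
  have h1 := lapl_comp_affine (f := u) 0 y R
  have h2 := fderiv_comp_affine (f := u) 0 y R
  simp only [zero_add] at h1 h2
  rw [lapl_const_mul hc, fderiv_const_mul (hc.differentiableAt (by simp)), h1, h2,
    coupling_mul hp (by positivity) (hu0 _ hRy) (hv0 _ hRy), ← Real.rpow_mul hR.le]
  have h3 := heq _ hRy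
  rw [norm_smul, norm_of_nonneg hR.le, map_smul, smul_eq_mul, Real.mul_rpow hR.le hpos.le] at h3
  simp only [smul_apply, smul_eq_mul]
  have h4 : R ^ (γ * (p - 1)) = R ^ γ * R ^ 2 * R ^ (2 * a - b * p) := by
    rw [← Real.rpow_natCast, ← Real.rpow_add hR, ← Real.rpow_add hR]
    congr 1
    push_cast
    linarith
  rw [h4]
  have h5 : 2 * a * (R * fderiv ℝ u (R • y) y) / (R * ‖y‖) ^ 2 * R ^ 2
      = 2 * a * (R * fderiv ℝ u (R • y) y) / ‖y‖ ^ 2 := by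
    field_simp
  linear_combination R ^ γ * R ^ 2 * h3 + R ^ γ * h5

lemma IsPositiveSolution.comp_smul (hγ : n - 2 - 2 * a = 2 * γ) (hpn : p * (b + γ) = n)
    (hp : α + β = p) {u v : Eu n → ℝ}
    (hs : IsPositiveSolution a (2 * a - b * p) p α β c d u v) {R : ℝ} (hR : 0 < R) :
    IsPositiveSolution a (2 * a - b * p) p α β c d (fun y => R ^ γ * u (R • y))
      (fun y => R ^ γ * v (R • y)) where
  contDiffAt_left x hx := contDiffAt_const.mul <| ContDiffAt.comp (g := u) x
    (hs.contDiffAt_left _ (smul_ne_zero hR.ne' hx)) (contDiff_const_smul R).contDiffAt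
  contDiffAt_right x hx := contDiffAt_const.mul <| ContDiffAt.comp (g := v) x
    (hs.contDiffAt_right _ (smul_ne_zero hR.ne' hx)) (contDiff_const_smul R).contDiffAt
  pos_left x hx := mul_pos (by positivity) (hs.pos_left _ (smul_ne_zero hR.ne' hx))
  pos_right x hx := mul_pos (by positivity) (hs.pos_right _ (smul_ne_zero hR.ne' hx))
  eq_left _ hx := equation_comp_smul hγ hpn hp hs.contDiffAt_left hs.pos_left hs.pos_right
    hs.eq_left hR hx
  eq_right _ hx := equation_comp_smul hγ hpn (by linarith) hs.contDiffAt_right hs.pos_right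
    hs.pos_left hs.eq_right hR hx

open scoped Pointwise in
lemma energy_comp_smul_le (ha : 0 ≤ a) (hγ : n - 2 - 2 * a = 2 * γ) {u : Eu n → ℝ}
    (hu : ∀ x, x ≠ 0 → ContDiffAt ℝ 2 u x) {x₀ : Eu n} (hx₀ : x₀ ≠ 0) :
    ∫ y in Metric.closedBall (‖x₀‖⁻¹ • x₀) (1 / 2),
        ‖fderiv ℝ (fun y => ‖x₀‖ ^ γ * u (‖x₀‖ • y)) y‖ ^ 2
      ≤ (3 / 2) ^ (2 * a) *
        ∫ x in Metric.closedBall x₀ (‖x₀‖ / 2), ‖x‖ ^ (-(2 * a)) * ‖fderiv ℝ u x‖ ^ 2 := by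
  have hR : 0 < ‖x₀‖ := norm_pos_iff.2 hx₀
  set R := ‖x₀‖ with hRdef
  have hball : R • Metric.closedBall (R⁻¹ • x₀) (1 / 2) = Metric.closedBall x₀ (R / 2) := by
    rw [smul_closedBall' hR.ne', smul_inv_smul₀ hR.ne', norm_of_nonneg hR.le]
    congr 1; ring
  have hne : ∀ y ∈ Metric.closedBall (R⁻¹ • x₀) (1 / 2), R • y ∈ Metric.closedBall x₀ (R / 2) :=
    fun y hy => hball ▸ Set.smul_mem_smul_set hy
  have hne' : ∀ x ∈ Metric.closedBall x₀ (R / 2), x ≠ 0 := fun x hx =>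
    norm_pos_iff.1 (by linarith [(norm_bounds_of_mem_closedBall_half hx).1])
  have h1 : ∀ y ∈ Metric.closedBall (R⁻¹ • x₀) (1 / 2),
      ‖fderiv ℝ (fun y => R ^ γ * u (R • y)) y‖ ^ 2
        = (R ^ γ * R) ^ 2 * ‖fderiv ℝ u (R • y)‖ ^ 2 := by
    intro y hy
    have hRy := hne' _ (hne y hy)
    have hc : ContDiffAt ℝ 2 (fun y : Eu n => u (R • y)) y :=
      ContDiffAt.comp (g := u) y (hu _ hRy) (contDiff_const_smul R).contDiffAt
    have h2 := fderiv_comp_affine (f := u) 0 y R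
    simp only [zero_add] at h2
    rw [fderiv_const_mul (hc.differentiableAt (by simp)), h2, smul_smul, norm_smul, mul_pow,
      norm_of_nonneg (by positivity)]
  rw [setIntegral_congr_fun Metric.isClosed_closedBall.measurableSet h1, integral_const_mul,
    Measure.setIntegral_comp_smul_of_pos volume (fun x => ‖fderiv ℝ u x‖ ^ 2) _ hR, hball,
    finrank_euclideanSpace_fin, smul_eq_mul, ← mul_assoc]
  have h3 : (R ^ γ * R) ^ 2 * (R ^ n)⁻¹ = R ^ (-(2 * a)) := by
    have e1 : (R ^ γ * R) ^ 2 = R ^ (2 * γ + 2) := by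
      rw [mul_pow, ← Real.rpow_natCast, ← Real.rpow_mul hR.le, ← Real.rpow_natCast R 2,
        ← Real.rpow_add hR]
      congr 1; push_cast; ring
    rw [e1, ← Real.rpow_natCast, ← Real.rpow_neg hR.le, ← Real.rpow_add hR]
    congr 1; linarith
  have hI := integrableOn_norm_fderiv_sq hu (isCompact_closedBall x₀ (R / 2)) hne'
  rw [h3, ← integral_const_mul, ← integral_const_mul]
  have hJ : IntegrableOn (fun x => ‖x‖ ^ (-(2 * a)) * ‖fderiv ℝ u x‖ ^ 2)
      (Metric.closedBall x₀ (R / 2)) := by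
    refine ContinuousOn.integrableOn_compact (isCompact_closedBall _ _) fun x hx => ?_
    have hx0 := hne' x hx
    exact ((continuous_norm.continuousAt.rpow_const (Or.inl (norm_ne_zero_iff.2 hx0))).mul
      ((hu x hx0).differentiableAt_fderiv.continuousAt.norm.pow 2)).continuousWithinAt
  refine setIntegral_mono_on (hI.const_mul _) (hJ.const_mul _)
    Metric.isClosed_closedBall.measurableSet fun x hx => ?_
  have hb := norm_bounds_of_mem_closedBall_half hx
  have hxpos : 0 < ‖x‖ := by linarith
  rw [← mul_assoc]
  refine mul_le_mul_of_nonneg_right ?_ (by positivity)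
  have h4 : ‖x‖ ^ (2 * a) ≤ (3 / 2) ^ (2 * a) * R ^ (2 * a) := by
    rw [← Real.mul_rpow (by norm_num) hR.le]
    exact Real.rpow_le_rpow hxpos.le hb.2 (by linarith)
  rw [Real.rpow_neg hR.le, Real.rpow_neg hxpos.le, ← div_eq_mul_inv, inv_eq_one_div,
    div_le_div_iff₀ (by positivity) (by positivity), one_mul]
  exact h4

/-- The rescaled solution vanishes at the origin and at infinity. -/
lemma exists_norm_rpow_mul_add_le (hn : 3 ≤ n) (ha : 0 ≤ a) (hab : a ≤ b) (hc : 0 ≤ c)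
    (hd : 0 ≤ d) (hα : 1 < α) (hβ : 1 < β) (hp : α + β = p) (hγ : n - 2 - 2 * a = 2 * γ)
    (hpn : p * (b + γ) = n) {u v : Eu n → ℝ}
    (hs : IsPositiveSolution a (2 * a - b * p) p α β c d u v)
    (hEu : Integrable fun x => ‖x‖ ^ (-(2 * a)) * ‖fderiv ℝ u x‖ ^ 2)
    (hEv : Integrable fun x => ‖x‖ ^ (-(2 * a)) * ‖fderiv ℝ v x‖ ^ 2)
    {s : ℝ} (hs' : s = 1 ∨ s = -1) {η : ℝ} (hη : 0 < η) :
    ∃ ρ > 0, ∀ x, x ≠ 0 → ‖x‖ ^ s ≤ ρ → ‖x‖ ^ γ * u x + ‖x‖ ^ γ * v x ≤ η := by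
  have hpn' : p * (n - 2) ≤ 2 * n := by nlinarith
  obtain ⟨ε, hε, hreg⟩ := exists_le_of_energy_le (k := 2 * a - b * p) hn ha hc hd hα hβ hp hpn' hη
  obtain ⟨ρ, hρ, hI⟩ := exists_setIntegral_le hs' (hEu.add hEv)
    (fun x => by simp only [Pi.add_apply]; positivity)
    (ε := ε / (3 / 2) ^ (2 * a)) (by positivity)
  refine ⟨ρ, hρ, fun x hx hxs => ?_⟩
  have hR : 0 < ‖x‖ := norm_pos_iff.2 hx
  have h1 := hreg _ _ (hs.comp_smul hγ hpn hp hR) (‖x‖⁻¹ • x)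
    (by rw [norm_smul, norm_inv, norm_norm, inv_mul_cancel₀ hR.ne'])
    (by
      have h2 := energy_comp_smul_le ha hγ hs.contDiffAt_left hx
      have h3 := energy_comp_smul_le ha hγ hs.contDiffAt_right hx
      have h4 := hI x hx hxs
      simp only [Pi.add_apply] at h4
      rw [integral_add hEu.integrableOn hEv.integrableOn, le_div_iff₀' (by positivity)] at h4
      linarith)
  simpa only [smul_inv_smul₀ hR.ne'] using h1

end Decay

section Limits

variable {n : ℕ}

lemma IsPositiveSolution.swap {a k p α β c d : ℝ} {u v : Eu n → ℝ}
    (h : IsPositiveSolution a k p α β c d u v) : IsPositiveSolution a k p β α d c v u :=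
  ⟨h.contDiffAt_right, h.contDiffAt_left, h.pos_right, h.pos_left, h.eq_right, h.eq_left⟩

lemma IsPositiveSolution.exists_tendsto {a b p c d α β γ : ℝ} (hn : 3 ≤ n) (ha : 0 ≤ a)
    (hab : a ≤ b) (hc : 0 ≤ c) (hd : 0 ≤ d) (hα : 1 < α) (hβ : 1 < β) (hp : α + β = p)
    (hγ0 : 0 < γ) (hγ : n - 2 - 2 * a = 2 * γ) (hpn : p * (b + γ) = n) {u v : Eu n → ℝ}
    (hs : IsPositiveSolution a (2 * a - b * p) p α β c d u v)
    (hEu : Integrable fun x => ‖x‖ ^ (-(2 * a)) * ‖fderiv ℝ u x‖ ^ 2)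
    (hEv : Integrable fun x => ‖x‖ ^ (-(2 * a)) * ‖fderiv ℝ v x‖ ^ 2) :
    (∃ L > 0, Tendsto u (𝓝[≠] 0) (𝓝 L)) ∧
      ∃ L > 0, Tendsto (fun x => ‖x‖ ^ ((n : ℝ) - 2 - 2 * a) * u x)
        (comap (fun x : Eu n => ‖x‖) atTop) (𝓝 L) := by
  have hpos : ∀ x : Eu n, x ≠ 0 → 0 < ‖x‖ ^ γ := fun x hx =>
    Real.rpow_pos_of_pos (norm_pos_iff.2 hx) _
  have key : ∀ s : ℝ, s = 1 ∨ s = -1 → ∃ L > 0, ∀ ε > 0, ∃ r > 0, ∀ x, x ≠ 0 → ‖x‖ ^ s ≤ r →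
      |‖x‖ ^ (-(s * γ)) * (‖x‖ ^ γ * u x) - L| ≤ ε := fun s hs' =>
    exists_limit_of_system (w := fun x => ‖x‖ ^ γ * u x) (z := fun x => ‖x‖ ^ γ * v x)
      hn hs' hγ0 hc hd hα hβ hp
      (fun x hx => (contDiffAt_norm_rpow hx γ).mul (hs.contDiffAt_left x hx))
      (fun x hx => (contDiffAt_norm_rpow hx γ).mul (hs.contDiffAt_right x hx))
      (fun x hx => mul_pos (hpos x hx) (hs.pos_left x hx))
      (fun x hx => mul_pos (hpos x hx) (hs.pos_right x hx))
      (fun x hx => cylLapl_rescaled hγ hpn hp hx (hs.contDiffAt_left x hx) (hs.pos_left x hx)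
        (hs.pos_right x hx) (hs.eq_left x hx))
      (fun x hx => cylLapl_rescaled hγ hpn (by linarith) hx (hs.contDiffAt_right x hx)
        (hs.pos_right x hx) (hs.pos_left x hx) (hs.eq_right x hx))
      (fun η hη => exists_norm_rpow_mul_add_le hn ha hab hc hd hα hβ hp hγ hpn hs hEu hEv hs' hη)
  constructor
  · obtain ⟨L, hL, h⟩ := key 1 (Or.inl rfl)
    refine ⟨L, hL, tendsto_nhdsNE_zero_of_abs_sub_le fun ε hε => ?_⟩
    obtain ⟨r, hr, hr'⟩ := h ε hε
    refine ⟨r, hr, fun x hx hxr => ?_⟩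
    have h1 := hr' x hx hxr
    rwa [← mul_assoc, ← Real.rpow_add (norm_pos_iff.2 hx), one_mul, neg_add_cancel,
      Real.rpow_zero, one_mul] at h1
  · obtain ⟨L, hL, h⟩ := key (-1) (Or.inr rfl)
    refine ⟨L, hL, tendsto_comap_norm_atTop_of_abs_sub_le fun ε hε => ?_⟩
    obtain ⟨r, hr, hr'⟩ := h ε hε
    refine ⟨r, hr, fun x hx hxr => ?_⟩
    have h1 := hr' x hx hxr
    rwa [← mul_assoc, ← Real.rpow_add (norm_pos_iff.2 hx),
      show -(-1 * γ) + γ = (n : ℝ) - 2 - 2 * a by linarith] at h1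

end Limits

theorem stmt {n : ℕ} (hn : 3 ≤ n) (a b p ν α β : ℝ)
    (ha0 : 0 ≤ a) (ha : a < ((n:ℝ)-2)/2) (hb0 : 0 < b) (hab : a ≤ b) (hba : b < a + 1)
    (hp : p = 2*(n:ℝ)/((n:ℝ)-2+2*(b-a))) (hν : 0 < ν) (hα : 1 < α) (hβ : 1 < β)
    (hαβ : α + β = p)
    (u v : EuclideanSpace ℝ (Fin n) → ℝ)
    (hu : ContDiffOn ℝ 2 u {0}ᶜ) (hv : ContDiffOn ℝ 2 v {0}ᶜ)
    (hupos : ∀ x : EuclideanSpace ℝ (Fin n), x ≠ 0 → 0 < u x)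
    (hvpos : ∀ x : EuclideanSpace ℝ (Fin n), x ≠ 0 → 0 < v x)
    (hueq : ∀ x : EuclideanSpace ℝ (Fin n), x ≠ 0 →
      -(wdiv a u x) = ‖x‖ ^ (-(b*p)) * (u x ^ (p-1) + ν*α * u x ^ (α-1) * v x ^ β))
    (hveq : ∀ x : EuclideanSpace ℝ (Fin n), x ≠ 0 →
      -(wdiv a v x) = ‖x‖ ^ (-(b*p)) * (v x ^ (p-1) + ν*β * u x ^ α * v x ^ (β-1)))
    (hEu : finiteEnergy a u) (hEv : finiteEnergy a v) :
    ∃ u₀ v₀ uinf vinf : ℝ, 0 < u₀ ∧ 0 < v₀ ∧ 0 < uinf ∧ 0 < vinf ∧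
      Tendsto u (𝓝[≠] (0 : EuclideanSpace ℝ (Fin n))) (𝓝 u₀) ∧
      Tendsto v (𝓝[≠] (0 : EuclideanSpace ℝ (Fin n))) (𝓝 v₀) ∧
      Tendsto (fun x : EuclideanSpace ℝ (Fin n) => ‖x‖ ^ ((n:ℝ)-2-2*a) * u x)
        (comap (fun x : EuclideanSpace ℝ (Fin n) => ‖x‖) atTop) (𝓝 uinf) ∧
      Tendsto (fun x : EuclideanSpace ℝ (Fin n) => ‖x‖ ^ ((n:ℝ)-2-2*a) * v x)
        (comap (fun x : EuclideanSpace ℝ (Fin n) => ‖x‖) atTop) (𝓝 vinf) := by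
  have hn' : (3 : ℝ) ≤ n := by exact_mod_cast hn
  have hpn : p * (b + ((n : ℝ) - 2 - 2 * a) / 2) = n := by
    have h1 : (n : ℝ) - 2 + 2 * (b - a) ≠ 0 := by
      have : 0 < (n : ℝ) - 2 + 2 * (b - a) := by linarith
      exact this.ne'
    rw [hp]
    field_simp
    ring
  have hs : IsPositiveSolution a (2 * a - b * p) p α β (ν * α) (ν * β) u v :=
    { contDiffAt_left := fun x hx => hu.contDiffAt (isOpen_compl_singleton.mem_nhds hx)
      contDiffAt_right := fun x hx => hv.contDiffAt (isOpen_compl_singleton.mem_nhds hx)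
      pos_left := hupos
      pos_right := hvpos
      eq_left := fun x hx => lapl_sub_eq_of_wdiv_eq hx (hueq x hx)
      eq_right := fun x hx => lapl_sub_eq_of_wdiv_eq hx <| (hveq x hx).trans <| by
        rw [coupling, mul_right_comm (ν * β)] }
  have hEu' : Integrable fun x => ‖x‖ ^ (-(2 * a)) * ‖fderiv ℝ u x‖ ^ 2 := by
    simpa only [finiteEnergy, norm_gradient] using hEu
  have hEv' : Integrable fun x => ‖x‖ ^ (-(2 * a)) * ‖fderiv ℝ v x‖ ^ 2 := by
    simpa only [finiteEnergy, norm_gradient] using hEv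
  have hc : 0 ≤ ν * α := by positivity
  have hd : 0 ≤ ν * β := by positivity
  have hγ0 : 0 < ((n : ℝ) - 2 - 2 * a) / 2 := by linarith
  obtain ⟨⟨u₀, hu₀, hu0⟩, uinf, huinf, hui⟩ :=
    hs.exists_tendsto hn ha0 hab hc hd hα hβ hαβ hγ0 (by ring) hpn hEu' hEv'
  obtain ⟨⟨v₀, hv₀, hv0⟩, vinf, hvinf, hvi⟩ :=
    hs.swap.exists_tendsto hn ha0 hab hd hc hβ hα (by linarith) hγ0 (by ring) hpn hEv' hEu'
  exact ⟨u₀, v₀, uinf, vinf, hu₀, hv₀, huinf, hvinf, hu0, hv0, hui, hvi⟩
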